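/- arXiv:2007.09103 — 7 statements merged into one kernel-verified Lean document; each statement's English description precedes it below -/
import Mathlib

section
/- Let D₀ = 𝕋 × [0,1] be the periodic channel. Suppose u₀ ∈ C²(D₀; ℝ²) and p₀ ∈ C¹(D₀) satisfy the steady Euler equations (u₀ · ∇)u₀ = −∇p₀ and ∇ · u₀ = 0 in D₀, with u₀ · e₂ = 0 on the two boundary lines {y₂ = 0} and {y₂ = 1}, and suppose inf_{D₀} |u₀| > 0. Then u₀ is a shear flow: there exists a function v : [0,1] → ℝ such that u₀(y₁, y₂) = (v(y₂), 0) for all (y₁, y₂) ∈ D₀. -/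
open Real

/-- First partial derivative of a scalar function on `ℝ × ℝ`. -/
noncomputable def pd1 (f : ℝ × ℝ → ℝ) (q : ℝ × ℝ) : ℝ := fderiv ℝ f q (1, 0)

/-- Second partial derivative of a scalar function on `ℝ × ℝ`. -/
noncomputable def pd2 (f : ℝ × ℝ → ℝ) (q : ℝ × ℝ) : ℝ := fderiv ℝ f q (0, 1)

/-- The periodic channel `𝕋 × [0,1]`, realized as the strip `ℝ × [0,1]`
(functions on it are `2π`-periodic in the first variable). -/
def chan : Set (ℝ × ℝ) := {q | q.2 ∈ Set.Icc (0 : ℝ) 1}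

open Set Filter Topology MeasureTheory

theorem fderiv_symm_of_contDiff_two {f : ℝ × ℝ → ℝ} (hf : ContDiff ℝ 2 f) (q h k : ℝ × ℝ) :
    fderiv ℝ (fderiv ℝ f) q h k = fderiv ℝ (fderiv ℝ f) q k h :=
  (hf.contDiffAt.isSymmSndFDerivAt (by simp)) h k

theorem differentiable_fderiv_of_contDiff_two {f : ℝ × ℝ → ℝ} (hf : ContDiff ℝ 2 f) :
    Differentiable ℝ (fderiv ℝ f) :=
  (hf.fderiv_right (m := 1) (by norm_num)).differentiable (by norm_num)

/-- The one-form `(a db - b da) / (a² + b²)` has a primitive (the polar angle of `(a, b)`) on any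
convex set on which `(a, b)` does not vanish. -/
theorem exists_polar_angle {a b : ℝ × ℝ → ℝ} (ha : ContDiff ℝ 2 a) (hb : ContDiff ℝ 2 b)
    {s : Set (ℝ × ℝ)} (hs : Convex ℝ s) (hN : ∀ q ∈ s, a q ^ 2 + b q ^ 2 ≠ 0) :
    ∃ θ : ℝ × ℝ → ℝ, ∀ q ∈ s, HasFDerivWithinAt θ
      ((a q ^ 2 + b q ^ 2)⁻¹ • (a q • fderiv ℝ b q - b q • fderiv ℝ a q)) s q := by
  have key : ∀ q ∈ s, HasFDerivAt
      (fun q => (a q ^ 2 + b q ^ 2)⁻¹ • (a q • fderiv ℝ b q - b q • fderiv ℝ a q)) _ q :=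
    fun q hq => by
      have h1 := (ha.differentiable (by norm_num) q).hasFDerivAt
      have h2 := (hb.differentiable (by norm_num) q).hasFDerivAt
      have h3 := (differentiable_fderiv_of_contDiff_two ha q).hasFDerivAt
      have h4 := (differentiable_fderiv_of_contDiff_two hb q).hasFDerivAt
      exact ((hasDerivAt_inv (hN q hq)).comp_hasFDerivAt q ((h1.pow 2).add (h2.pow 2))).smul
        ((h1.smul h4).sub (h2.smul h3))
  refine hs.exists_forall_hasFDerivWithinAt_of_hasFDerivWithinAt_symmetric
    (fun q hq => (key q hq).hasFDerivWithinAt) ?_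
  intro q hq h _ k _
  have hsa := fderiv_symm_of_contDiff_two ha q h k
  have hsb := fderiv_symm_of_contDiff_two hb q h k
  have := hN q hq
  simp [hsa, hsb]
  field_simp
  ring

theorem hasFDerivAt_fderiv_apply {f : ℝ × ℝ → ℝ} (hf : ContDiff ℝ 2 f) (q v : ℝ × ℝ) :
    HasFDerivAt (fun x => fderiv ℝ f x v) ((fderiv ℝ (fderiv ℝ f) q).flip v) q :=
  by simpa using ((differentiable_fderiv_of_contDiff_two hf q).hasFDerivAt).clm_apply
      (hasFDerivAt_const v q)

/-- A steady incompressible Euler flow `(a, b)` satisfies `a Δb = b Δa`. -/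
theorem euler_mul_laplacian_eq {a b p : ℝ × ℝ → ℝ} (ha : ContDiff ℝ 2 a) (hb : ContDiff ℝ 2 b)
    (hp : ContDiff ℝ 1 p) {s : Set (ℝ × ℝ)} (hs : IsOpen s)
    (heuler1 : ∀ q ∈ s, a q * pd1 a q + b q * pd2 a q = -pd1 p q)
    (heuler2 : ∀ q ∈ s, a q * pd1 b q + b q * pd2 b q = -pd2 p q)
    (hdiv : ∀ q ∈ s, pd1 a q + pd2 b q = 0) {q : ℝ × ℝ} (hq : q ∈ s) :
    a q * (fderiv ℝ (fderiv ℝ b) q (1, 0) (1, 0) + fderiv ℝ (fderiv ℝ b) q (0, 1) (0, 1)) =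
      b q * (fderiv ℝ (fderiv ℝ a) q (1, 0) (1, 0) + fderiv ℝ (fderiv ℝ a) q (0, 1) (0, 1)) := by
  have hsq : ∀ᶠ x in 𝓝 q, x ∈ s := hs.mem_nhds hq
  have h1 := (ha.differentiable (by norm_num) q).hasFDerivAt
  have h2 := (hb.differentiable (by norm_num) q).hasFDerivAt
  have A1 := hasFDerivAt_fderiv_apply ha q (1, 0)
  have A2 := hasFDerivAt_fderiv_apply ha q (0, 1)
  have B1 := hasFDerivAt_fderiv_apply hb q (1, 0)
  have B2 := hasFDerivAt_fderiv_apply hb q (0, 1)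
  have hD : (fderiv ℝ (fderiv ℝ a) q).flip (1, 0) + (fderiv ℝ (fderiv ℝ b) q).flip (0, 1) = 0 := by
    refine (A1.add B2).unique ((hasFDerivAt_const (0 : ℝ) q).congr_of_eventuallyEq ?_)
    filter_upwards [hsq] with x hx using hdiv x hx
  have E1 := (h1.mul A1).add (h2.mul A2)
  have E2 := (h1.mul B1).add (h2.mul B2)
  have F := ((E1.smul_const (ContinuousLinearMap.fst ℝ ℝ ℝ)).add
    (E2.smul_const (ContinuousLinearMap.snd ℝ ℝ ℝ))).neg
  have hev : ∀ᶠ x in 𝓝 q, HasFDerivAt p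
      (-((a x * fderiv ℝ a x (1, 0) + b x * fderiv ℝ a x (0, 1)) • ContinuousLinearMap.fst ℝ ℝ ℝ +
        (a x * fderiv ℝ b x (1, 0) + b x * fderiv ℝ b x (0, 1)) •
          ContinuousLinearMap.snd ℝ ℝ ℝ)) x := by
    filter_upwards [hsq] with x hx
    have e1 := heuler1 x hx
    have e2 := heuler2 x hx
    simp only [pd1, pd2] at e1 e2
    refine (hp.differentiable (by norm_num) x).hasFDerivAt.congr_fderiv ?_
    ext <;> simp [e1, e2]
  have hsym := second_derivative_symmetric_of_eventually_of_real hev F (1, 0) (0, 1)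
  have d := hdiv q hq
  have d1 := DFunLike.congr_fun hD (1, 0)
  have d2 := DFunLike.congr_fun hD (0, 1)
  have s1 := fderiv_symm_of_contDiff_two ha q (1, 0) (0, 1)
  have s2 := fderiv_symm_of_contDiff_two hb q (1, 0) (0, 1)
  simp at hsym d1 d2
  simp only [pd1, pd2] at d
  linear_combination -hsym - b q * d1 + a q * d2 +
    (fderiv ℝ a q (0, 1) - fderiv ℝ b q (1, 0)) * d

theorem convex_chan : Convex ℝ chan :=
  (convex_Icc (0 : ℝ) 1).linear_preimage (LinearMap.snd ℝ ℝ ℝ)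

theorem mem_nhds_chan {q : ℝ × ℝ} (hq : q.2 ∈ Ioo (0 : ℝ) 1) : chan ∈ 𝓝 q :=
  mem_of_superset ((isOpen_Ioo.preimage continuous_snd).mem_nhds hq)
    fun _ hz => Ioo_subset_Icc_self hz

theorem closure_snd_preimage_Ioo :
    closure {q : ℝ × ℝ | q.2 ∈ Ioo (0 : ℝ) 1} = chan := by
  have h1 : {q : ℝ × ℝ | q.2 ∈ Ioo (0 : ℝ) 1} = univ ×ˢ Ioo 0 1 := by ext; simp
  have h2 : chan = univ ×ˢ Icc (0 : ℝ) 1 := by ext; simp [chan]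
  rw [h1, h2, closure_prod_eq, closure_univ, closure_Ioo (by norm_num)]

/-- A nonnegative continuous function on a rectangle with zero integral vanishes inside. -/
theorem eq_zero_of_integral_rectangle_eq_zero {h : ℝ × ℝ → ℝ} {L : ℝ} (hL : 0 ≤ L)
    (hc : ContinuousOn h (Icc 0 L ×ˢ Icc 0 1)) (h0 : ∀ q ∈ Icc 0 L ×ˢ Icc 0 1, 0 ≤ h q)
    (hint : ∫ x in (0 : ℝ)..L, ∫ y in (0 : ℝ)..1, h (x, y) = 0) :
    ∀ q ∈ Ioo 0 L ×ˢ Ioo 0 1, h q = 0 := by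
  have hI : IntegrableOn h (Icc 0 L ×ˢ Icc 0 1) :=
    hc.integrableOn_compact (isCompact_Icc.prod isCompact_Icc)
  have hI' : IntegrableOn h (Icc 0 L ×ˢ Icc 0 1) (volume.prod volume) := hI
  have hset : ∫ q in Icc 0 L ×ˢ Icc 0 1, h q = 0 := by
    refine Eq.trans ?_ hint
    rw [intervalIntegral.integral_of_le hL, ← integral_Icc_eq_integral_Ioc,
      Measure.volume_eq_prod, setIntegral_prod h hI']
    refine setIntegral_congr_fun measurableSet_Icc fun x _ => ?_
    rw [intervalIntegral.integral_of_le zero_le_one, ← integral_Icc_eq_integral_Ioc]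
  have hm : MeasurableSet (Icc (0 : ℝ) L ×ˢ Icc (0 : ℝ) 1) :=
    measurableSet_Icc.prod measurableSet_Icc
  rw [setIntegral_eq_zero_iff_of_nonneg_ae ((ae_restrict_iff' hm).2 (.of_forall h0)) hI] at hset
  have hsub : Ioo (0 : ℝ) L ×ˢ Ioo (0 : ℝ) 1 ⊆ Icc 0 L ×ˢ Icc 0 1 :=
    prod_mono Ioo_subset_Icc_self Ioo_subset_Icc_self
  exact Measure.eqOn_open_of_ae_eq (ae_restrict_of_ae_restrict_of_subset hsub hset)
    (isOpen_Ioo.prod isOpen_Ioo) (hc.mono hsub) continuousOn_const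

theorem hasDerivAt_comp_horizontal {θ : ℝ × ℝ → ℝ} {D : ℝ × ℝ →L[ℝ] ℝ} {x y : ℝ}
    (hy : y ∈ Icc (0 : ℝ) 1) (h : HasFDerivWithinAt θ D chan (x, y)) :
    HasDerivAt (fun t => θ (t, y)) (D (1, 0)) x := by
  rw [← hasDerivWithinAt_univ]
  exact h.comp_hasDerivWithinAt x
    ((hasDerivAt_id x).prodMk (hasDerivAt_const x y)).hasDerivWithinAt (fun _ _ => hy)

/-- Energy argument: if the divergence-free field `(W₁, W₂)` is a positive multiple of a gradient
on the channel, is normal to the boundary and has zero flux through it, then it vanishes. -/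
theorem eq_zero_of_divergence_free_of_gradient {θ ρ W₁ W₂ : ℝ × ℝ → ℝ} {L : ℝ} (hL : 0 < L)
    (hW₁ : ContDiff ℝ 1 W₁) (hW₂ : ContDiff ℝ 1 W₂)
    (hdiv : ∀ q ∈ chan, fderiv ℝ W₁ q (1, 0) + fderiv ℝ W₂ q (0, 1) = 0)
    (hρc : ContinuousOn ρ chan) (hρ : ∀ q ∈ chan, 0 < ρ q)
    (hθ : ∀ q ∈ chan, HasFDerivWithinAt θ
      (ρ q • (W₁ q • ContinuousLinearMap.fst ℝ ℝ ℝ + W₂ q • ContinuousLinearMap.snd ℝ ℝ ℝ)) chan q)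
    (hρper : ∀ x y, ρ (x + L, y) = ρ (x, y)) (hW₁per : ∀ x y, W₁ (x + L, y) = W₁ (x, y))
    (hW₂per : ∀ x y, W₂ (x + L, y) = W₂ (x, y))
    (hbd : ∀ x y, (y = 0 ∨ y = 1) → W₁ (x, y) = 0)
    (hflux : ∀ y, (y = 0 ∨ y = 1) → ∫ x in (0 : ℝ)..L, W₂ (x, y) = 0) :
    ∀ q ∈ chan, W₁ q = 0 ∧ W₂ q = 0 := by
  have hmem : ∀ y : ℝ, (y = 0 ∨ y = 1) → y ∈ Icc (0 : ℝ) 1 := by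
    rintro y (rfl | rfl) <;> simp
  have hθbd : ∀ x y, (y = 0 ∨ y = 1) → θ (x, y) = θ (0, y) := by
    intro x y hy
    have hd : ∀ t, HasDerivAt (fun t => θ (t, y)) 0 t := fun t => by
      simpa [hbd t y hy] using hasDerivAt_comp_horizontal (hmem y hy) (hθ (t, y) (hmem y hy))
    exact is_const_of_deriv_eq_zero (fun t => (hd t).differentiableAt) (fun t => (hd t).deriv) x 0
  have hθper : ∀ y ∈ Icc (0 : ℝ) 1, ∀ x, θ (x + L, y) = θ (x, y) := by
    intro y hy x
    have hd : ∀ q ∈ chan, HasFDerivWithinAt (fun q => θ (q + (L, 0)) - θ q)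
        (0 : ℝ × ℝ →L[ℝ] ℝ) chan q := by
      rintro ⟨s, t⟩ hq
      have hq' : ((s, t) : ℝ × ℝ) + (L, 0) ∈ chan := by simpa [chan] using hq
      have h1 := (hθ _ hq').comp (s, t) ((hasFDerivWithinAt_id _ _).add_const (L, (0 : ℝ)))
        (fun q hq => by simpa [chan] using hq : MapsTo _ chan chan)
      refine (h1.sub (hθ _ hq)).congr_fderiv ?_
      ext <;> simp [hρper, hW₁per, hW₂per]
    have hle := convex_chan.norm_image_sub_le_of_norm_hasFDerivWithin_le (C := 0) hd (by simp)
      (show ((0 : ℝ), (0 : ℝ)) ∈ chan by simp [chan]) (show (x, y) ∈ chan from hy)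
    have h0 := hθbd L 0 (.inl rfl)
    simp [h0, sub_eq_zero] at hle
    exact hle
  have hθc : ContinuousOn θ chan := fun q hq => (hθ q hq).continuousWithinAt
  have hsub : Icc 0 L ×ˢ Icc 0 1 ⊆ chan := fun q hq => hq.2
  have hcW₁ := hW₁.continuous
  have hcW₂ := hW₂.continuous
  set f' : (ℝ × ℝ → ℝ) → ℝ × ℝ → (ℝ × ℝ →L[ℝ] ℝ) := fun W q =>
    θ q • fderiv ℝ W q + W q •
      (ρ q • (W₁ q • ContinuousLinearMap.fst ℝ ℝ ℝ + W₂ q • ContinuousLinearMap.snd ℝ ℝ ℝ)) with hf'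
  have hder : ∀ W : ℝ × ℝ → ℝ, ContDiff ℝ 1 W → ∀ q ∈ Ioo (min 0 L) (max 0 L) ×ˢ
      Ioo (min (0 : ℝ) 1) (max 0 1), HasFDerivAt (fun q => θ q * W q) (f' W q) q := by
    intro W hW q hq
    simp only [min_eq_left hL.le, max_eq_right hL.le, min_eq_left (zero_le_one' ℝ),
      max_eq_right (zero_le_one' ℝ)] at hq
    have hn : chan ∈ 𝓝 q := mem_nhds_chan hq.2
    exact ((hθ q (mem_of_mem_nhds hn)).hasFDerivAt hn).mul
      (hW.differentiable (by norm_num) q).hasFDerivAt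
  have heq : ∀ q ∈ chan, f' W₁ q (1, 0) + f' W₂ q (0, 1) = ρ q * (W₁ q ^ 2 + W₂ q ^ 2) := by
    intro q hq
    simp [hf']
    linear_combination θ q * hdiv q hq
  have hcont : ContinuousOn (fun q => ρ q * (W₁ q ^ 2 + W₂ q ^ 2)) (Icc 0 L ×ˢ Icc 0 1) :=
    (hρc.mono hsub).mul (by fun_prop)
  have hint := integral2_divergence_prod_of_hasFDerivAt (fun q => θ q * W₁ q)
    (fun q => θ q * W₂ q) (f' W₁) (f' W₂) 0 0 L 1
    ((hθc.mul hcW₁.continuousOn).mono (by rwa [uIcc_of_le hL.le, uIcc_of_le zero_le_one]))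
    ((hθc.mul hcW₂.continuousOn).mono (by rwa [uIcc_of_le hL.le, uIcc_of_le zero_le_one]))
    (hder W₁ hW₁) (hder W₂ hW₂)
    (by
      rw [uIcc_of_le hL.le, uIcc_of_le zero_le_one]
      exact (hcont.congr fun q hq => heq q (hsub hq)).integrableOn_compact
        (isCompact_Icc.prod isCompact_Icc))
  have hfluxθ : ∀ y, (y = 0 ∨ y = 1) → ∫ x in (0 : ℝ)..L, θ (x, y) * W₂ (x, y) = 0 := by
    intro y hy
    simp only [hθbd _ y hy, intervalIntegral.integral_const_mul, hflux y hy, mul_zero]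
  have hside : ∫ y in (0 : ℝ)..1, θ (L, y) * W₁ (L, y) =
      ∫ y in (0 : ℝ)..1, θ (0, y) * W₁ (0, y) := by
    refine intervalIntegral.integral_congr fun y hy => ?_
    rw [uIcc_of_le zero_le_one] at hy
    have h1 := hθper y hy 0
    have h2 := hW₁per 0 y
    rw [zero_add] at h1 h2
    simp only [h1, h2]
  rw [hfluxθ 0 (.inl rfl), hfluxθ 1 (.inr rfl), hside] at hint
  have hzero : ∫ x in (0 : ℝ)..L, ∫ y in (0 : ℝ)..1,
      (fun q : ℝ × ℝ => ρ q * (W₁ q ^ 2 + W₂ q ^ 2)) (x, y) = 0 := by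
    refine Eq.trans ?_ (hint.trans (by ring))
    refine intervalIntegral.integral_congr fun x _ => intervalIntegral.integral_congr fun y hy => ?_
    rw [uIcc_of_le zero_le_one] at hy
    exact (heq (x, y) hy).symm
  have hin := eq_zero_of_integral_rectangle_eq_zero hL.le hcont
    (fun q hq => mul_nonneg (hρ q (hsub hq)).le (by positivity)) hzero
  have hrect : ∀ q ∈ Icc 0 L ×ˢ Icc 0 1, W₁ q = 0 ∧ W₂ q = 0 := by
    have hcl : Icc 0 L ×ˢ Icc 0 1 = closure (Ioo (0 : ℝ) L ×ˢ Ioo (0 : ℝ) 1) := by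
      rw [closure_prod_eq, closure_Ioo hL.ne, closure_Ioo zero_ne_one]
    rw [hcl]
    refine closure_minimal (t := {q | W₁ q = 0 ∧ W₂ q = 0}) (fun q hq => ?_)
      ((isClosed_eq hcW₁ continuous_const).inter (isClosed_eq hcW₂ continuous_const))
    have hp := hρ q (Ioo_subset_Icc_self hq.2)
    have h2 := (mul_eq_zero.1 (hin q hq)).resolve_left hp.ne'
    constructor <;> nlinarith [sq_nonneg (W₁ q), sq_nonneg (W₂ q)]
  rintro ⟨x, y⟩ hq
  have p1 : Function.Periodic (fun t => W₁ (t, y)) L := fun t => hW₁per t y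
  have p2 : Function.Periodic (fun t => W₂ (t, y)) L := fun t => hW₂per t y
  have pp : Function.Periodic (fun t => (W₁ (t, y), W₂ (t, y))) L := fun t => by
    simp only [hW₁per, hW₂per]
  obtain ⟨t, ht, hxt⟩ := pp.exists_mem_Ico₀ hL x
  have := hrect (t, y) ⟨Ico_subset_Icc_self ht, hq⟩
  simp only [Prod.mk.injEq] at hxt
  rwa [hxt.1, hxt.2]

theorem eq_zero_on_chan_of_eq_zero_on_interior {f : ℝ × ℝ → ℝ} (hf : Continuous f)
    (h : ∀ q : ℝ × ℝ, q.2 ∈ Ioo (0 : ℝ) 1 → f q = 0) : ∀ q ∈ chan, f q = 0 := by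
  rw [← closure_snd_preimage_Ioo]
  exact closure_minimal (t := {q | f q = 0}) h (isClosed_eq hf continuous_const)

theorem hasDerivAt_horizontal {f : ℝ × ℝ → ℝ} (hf : Differentiable ℝ f) (x y : ℝ) :
    HasDerivAt (fun t => f (t, y)) (fderiv ℝ f (x, y) (1, 0)) x :=
  HasFDerivAt.comp_hasDerivAt x (hf (x, y)).hasFDerivAt
    ((hasDerivAt_id x).prodMk (hasDerivAt_const x y))

theorem hasDerivAt_vertical {f : ℝ × ℝ → ℝ} (hf : Differentiable ℝ f) (x y : ℝ) :
    HasDerivAt (fun t => f (x, t)) (fderiv ℝ f (x, y) (0, 1)) y :=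
  HasFDerivAt.comp_hasDerivAt y (hf (x, y)).hasFDerivAt
    ((hasDerivAt_const y x).prodMk (hasDerivAt_id y))

theorem fderiv_horizontal_periodic {f : ℝ × ℝ → ℝ} {L : ℝ}
    (hf : ∀ q : ℝ × ℝ, f (q.1 + L, q.2) = f q) (x y : ℝ) :
    fderiv ℝ f (x + L, y) = fderiv ℝ f (x, y) := by
  have h := fderiv_comp_add_right (𝕜 := ℝ) (f := f) (x := (x, y)) (L, (0 : ℝ))
  have hfun : (fun q : ℝ × ℝ => f (q + (L, 0))) = f := by
    ext q
    rw [← hf q]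
    congr 1
    ext <;> simp
  rw [hfun] at h
  rw [h]
  simp

/-- If the vector `(a, b)` does not vanish, does not rotate on `[0, 1]` and is horizontal at `0`,
then it stays horizontal. -/
theorem eq_zero_of_wronskian_eq_zero {a b a' b' : ℝ → ℝ} (ha : ∀ t, HasDerivAt a (a' t) t)
    (hb : ∀ t, HasDerivAt b (b' t) t) (hN : ∀ t ∈ Icc (0 : ℝ) 1, a t ^ 2 + b t ^ 2 ≠ 0)
    (hw : ∀ t ∈ Icc (0 : ℝ) 1, a t * b' t - b t * a' t = 0) (h0 : b 0 = 0) :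
    ∀ t ∈ Icc (0 : ℝ) 1, b t = 0 := by
  intro t ht
  have hd : ∀ s ∈ Icc (0 : ℝ) 1, HasDerivAt (fun s => b s ^ 2 / (a s ^ 2 + b s ^ 2)) 0 s := by
    intro s hs
    refine (((hb s).pow 2).div (((ha s).pow 2).add ((hb s).pow 2)) (hN s hs)).congr_deriv ?_
    rw [div_eq_zero_iff]
    left
    simp
    linear_combination 2 * a s * b s * hw s hs
  have h := constant_of_has_deriv_right_zero
    (fun s hs => (hd s hs).continuousAt.continuousWithinAt)
    (fun s hs => (hd s (Ico_subset_Icc_self hs)).hasDerivWithinAt) t ht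
  simpa [h0, hN t ht] using h

theorem horizontal_of_euler {a b p : ℝ × ℝ → ℝ} {L : ℝ} (hL : 0 < L) (ha : ContDiff ℝ 2 a)
    (hb : ContDiff ℝ 2 b) (hp : ContDiff ℝ 1 p) (haper : ∀ q : ℝ × ℝ, a (q.1 + L, q.2) = a q)
    (hbper : ∀ q : ℝ × ℝ, b (q.1 + L, q.2) = b q)
    (heuler1 : ∀ q ∈ chan, a q * pd1 a q + b q * pd2 a q = -pd1 p q)
    (heuler2 : ∀ q ∈ chan, a q * pd1 b q + b q * pd2 b q = -pd2 p q)
    (hdiv : ∀ q ∈ chan, pd1 a q + pd2 b q = 0)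
    (hbc : ∀ q : ℝ × ℝ, (q.2 = 0 ∨ q.2 = 1) → b q = 0)
    (hN : ∀ q ∈ chan, 0 < a q ^ 2 + b q ^ 2) : ∀ q ∈ chan, b q = 0 := by
  have ha1 : ContDiff ℝ 1 a := ha.of_le (by norm_num)
  have hb1 : ContDiff ℝ 1 b := hb.of_le (by norm_num)
  have hda := ha1.differentiable (by norm_num)
  have hdb := hb1.differentiable (by norm_num)
  have hcd : ∀ f : ℝ × ℝ → ℝ, ContDiff ℝ 2 f → ∀ v, ContDiff ℝ 1 (fun q => fderiv ℝ f q v) :=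
    fun f hf v => (hf.fderiv_right (m := 1) (by norm_num)).clm_apply contDiff_const
  set W : ℝ × ℝ → ℝ × ℝ → ℝ := fun v q => a q * fderiv ℝ b q v - b q * fderiv ℝ a q v with hWdef
  have hW : ∀ v, ContDiff ℝ 1 (W v) := fun v =>
    (ha1.mul (hcd b hb v)).sub (hb1.mul (hcd a ha v))
  have hWper : ∀ v x y, W v (x + L, y) = W v (x, y) := fun v x y => by
    have h1 := haper (x, y)
    have h2 := hbper (x, y)
    simp only at h1 h2
    simp only [hWdef, h1, h2, fderiv_horizontal_periodic haper, fderiv_horizontal_periodic hbper]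
  have hWdiv : ∀ q ∈ chan, fderiv ℝ (W (1, 0)) q (1, 0) + fderiv ℝ (W (0, 1)) q (0, 1) = 0 := by
    refine eq_zero_on_chan_of_eq_zero_on_interior
      ((((hW _).continuous_fderiv (by norm_num)).clm_apply continuous_const).add
        (((hW _).continuous_fderiv (by norm_num)).clm_apply continuous_const)) fun q hq => ?_
    have hWd : ∀ v, HasFDerivAt (W v) _ q := fun v =>
      ((hda q).hasFDerivAt.mul (hasFDerivAt_fderiv_apply hb q v)).sub
        ((hdb q).hasFDerivAt.mul (hasFDerivAt_fderiv_apply ha q v))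
    have hl := euler_mul_laplacian_eq ha hb hp (isOpen_Ioo.preimage continuous_snd)
      (fun z hz => heuler1 z (Ioo_subset_Icc_self hz))
      (fun z hz => heuler2 z (Ioo_subset_Icc_self hz))
      (fun z hz => hdiv z (Ioo_subset_Icc_self hz)) (q := q) hq
    rw [(hWd _).fderiv, (hWd _).fderiv]
    simp
    linear_combination hl
  obtain ⟨θ, hθ⟩ := exists_polar_angle ha hb convex_chan fun q hq => (hN q hq).ne'
  have hb0 : ∀ x y, (y = 0 ∨ y = 1) → fderiv ℝ b (x, y) (1, 0) = 0 := by
    intro x y hy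
    refine (hasDerivAt_horizontal hdb x y).unique ?_
    have : (fun t => b (t, y)) = fun _ => 0 := funext fun t => hbc (t, y) hy
    rw [this]
    exact hasDerivAt_const x 0
  have hWzero := eq_zero_of_divergence_free_of_gradient (θ := θ)
    (ρ := fun q => (a q ^ 2 + b q ^ 2)⁻¹) hL (hW (1, 0)) (hW (0, 1)) hWdiv
    (ContinuousOn.inv₀ (by have := ha.continuous; have := hb.continuous; fun_prop)
      fun q hq => (hN q hq).ne')
    (fun q hq => inv_pos.2 (hN q hq))
    (fun q hq => (hθ q hq).congr_fderiv (by ext <;> simp [hWdef]))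
    (fun x y => by
      have h1 := haper (x, y)
      have h2 := hbper (x, y)
      simp only at h1 h2
      simp only [h1, h2])
    (hWper _) (hWper _)
    (fun x y hy => by simp [hWdef, hb0 x y hy, hbc (x, y) hy])
    (fun y hy => by
      have hmem : ∀ x : ℝ, (x, y) ∈ chan := fun x => by
        rcases hy with rfl | rfl <;> simp [chan]
      have hd : ∀ x : ℝ, HasDerivAt (fun t => -(a (t, y) ^ 2) / 2) (W (0, 1) (x, y)) x := by
        intro x
        refine ((((hasDerivAt_horizontal hda x y).pow 2).neg).div_const 2).congr_deriv ?_
        have h := hdiv (x, y) (hmem x)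
        simp only [pd1, pd2] at h
        simp [hWdef, hbc (x, y) hy]
        linear_combination -a (x, y) * h
      rw [intervalIntegral.integral_eq_sub_of_hasDerivAt (fun x _ => hd x)
        (((hW _).continuous.comp (by fun_prop)).intervalIntegrable _ _)]
      have h1 := haper (0, y)
      simp only [zero_add] at h1
      simp [h1])
  rintro ⟨x, y⟩ hq
  exact eq_zero_of_wronskian_eq_zero (fun t => hasDerivAt_vertical hda x t)
    (fun t => hasDerivAt_vertical hdb x t) (fun t ht => (hN (x, t) ht).ne')
    (fun t ht => (hWzero (x, t) ht).2) (hbc (x, 0) (.inl rfl)) y hq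

/-- Rigidity of non-stagnant steady Euler flows in the periodic channel:
any `C²` steady Euler flow tangent to the boundary with no stagnation points
is a shear flow. -/
theorem rigidity_nonstagnant_euler
    (u : ℝ × ℝ → ℝ × ℝ) (p : ℝ × ℝ → ℝ)
    (hu : ContDiff ℝ 2 u) (hp : ContDiff ℝ 1 p)
    (huper : ∀ q : ℝ × ℝ, u (q.1 + 2 * π, q.2) = u q)
    (hpper : ∀ q : ℝ × ℝ, p (q.1 + 2 * π, q.2) = p q)
    (heuler1 : ∀ q ∈ chan,
      (u q).1 * pd1 (fun x => (u x).1) q + (u q).2 * pd2 (fun x => (u x).1) q = - pd1 p q)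
    (heuler2 : ∀ q ∈ chan,
      (u q).1 * pd1 (fun x => (u x).2) q + (u q).2 * pd2 (fun x => (u x).2) q = - pd2 p q)
    (hdiv : ∀ q ∈ chan, pd1 (fun x => (u x).1) q + pd2 (fun x => (u x).2) q = 0)
    (hbc : ∀ q : ℝ × ℝ, (q.2 = 0 ∨ q.2 = 1) → (u q).2 = 0)
    (c : ℝ) (hc : 0 < c)
    (hstag : ∀ q ∈ chan, c ≤ Real.sqrt ((u q).1 ^ 2 + (u q).2 ^ 2)) :
    ∃ v : ℝ → ℝ, ∀ q ∈ chan, u q = (v q.2, 0) := by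
  have ha : ContDiff ℝ 2 (fun x => (u x).1) := hu.fst
  have hb : ContDiff ℝ 2 (fun x => (u x).2) := hu.snd
  have hda := ha.differentiable (by norm_num)
  have hN : ∀ q ∈ chan, 0 < (u q).1 ^ 2 + (u q).2 ^ 2 := fun q hq =>
    Real.sqrt_pos.1 (hc.trans_le (hstag q hq))
  have hb0 := horizontal_of_euler two_pi_pos ha hb hp (fun q => congrArg Prod.fst (huper q))
    (fun q => congrArg Prod.snd (huper q)) heuler1 heuler2 hdiv hbc hN
  have ha0 : ∀ q ∈ chan, fderiv ℝ (fun x => (u x).1) q (1, 0) = 0 := by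
    refine eq_zero_on_chan_of_eq_zero_on_interior
      ((ha.continuous_fderiv (by norm_num)).clm_apply continuous_const) fun q hq => ?_
    have hz : fderiv ℝ (fun x => (u x).2) q = 0 :=
      ((hasFDerivAt_const (0 : ℝ) q).congr_of_eventuallyEq
        (eventually_of_mem (mem_nhds_chan hq) hb0)).fderiv
    simpa [pd1, pd2, hz] using hdiv q (Ioo_subset_Icc_self hq)
  refine ⟨fun y => (u (0, y)).1, ?_⟩
  rintro ⟨x, y⟩ hq
  have hd : ∀ t, HasDerivAt (fun t => (u (t, y)).1) 0 t := fun t =>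
    (hasDerivAt_horizontal hda t y).congr_deriv (ha0 (t, y) hq)
  exact Prod.ext (is_const_of_deriv_eq_zero (fun t => (hd t).differentiableAt)
    (fun t => (hd t).deriv) x 0) (hb0 (x, y) hq)
end

section
/- Let D₀ = 𝕋 × [1/2, 1] and let f : [1/2,1] → ℝ, g : [1/2,1] × ℝ → ℝ, h : ℝ → ℝ be Lipschitz functions. Let ψ ∈ C²(D₀) be 2π-periodic in the first variable x and solve Δψ + f(y) ∂_y ψ + g(y, ψ) + h(ψ) = 0 in D₀, with boundary values ψ(x, 1/2) = 0 and ψ(x, 1) = c for some constant c > 0. Suppose that f is nondecreasing, g(·, s) is nondecreasing in y for every fixed s, and that one of the following holds: (i) 0 < ψ < c in the interior of D₀, or (ii) ∂_y ψ ≥ 0 on D₀. Then ψ is independent of x, i.e. ψ(x, y) = ψ̄(y) for some function ψ̄. -/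
open Real

/-- Laplacian of a scalar function on `ℝ × ℝ`. -/
noncomputable def lap (f : ℝ × ℝ → ℝ) (q : ℝ × ℝ) : ℝ := pd1 (pd1 f) q + pd2 (pd2 f) q

/-- The periodic strip `𝕋 × [1/2, 1]`. -/
def strip : Set (ℝ × ℝ) := {q | q.2 ∈ Set.Icc (1 / 2 : ℝ) 1}


open Set Filter Topology

section PartialDerivatives

variable {G H : ℝ × ℝ → ℝ}

lemma hasDerivAt_pd1 {q : ℝ × ℝ} (hG : DifferentiableAt ℝ G q) :
    HasDerivAt (fun s => G (s, q.2)) (pd1 G q) q.1 :=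
  hG.hasFDerivAt.comp_hasDerivAt (f := fun s : ℝ => (s, q.2)) q.1
    ((hasDerivAt_id q.1).prodMk (hasDerivAt_const q.1 q.2))

lemma hasDerivAt_pd2 {q : ℝ × ℝ} (hG : DifferentiableAt ℝ G q) :
    HasDerivAt (fun s => G (q.1, s)) (pd2 G q) q.2 :=
  hG.hasFDerivAt.comp_hasDerivAt (f := fun s : ℝ => (q.1, s)) q.2
    ((hasDerivAt_const q.2 q.1).prodMk (hasDerivAt_id q.2))

lemma contDiff_pd1 (hG : ContDiff ℝ 2 G) : ContDiff ℝ 1 (pd1 G) :=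
  (hG.fderiv_right (m := 1) (by norm_num)).clm_apply contDiff_const

lemma contDiff_pd2 (hG : ContDiff ℝ 2 G) : ContDiff ℝ 1 (pd2 G) :=
  (hG.fderiv_right (m := 1) (by norm_num)).clm_apply contDiff_const

lemma pd1_sub (hG : Differentiable ℝ G) (hH : Differentiable ℝ H) :
    pd1 (fun p => G p - H p) = fun p => pd1 G p - pd1 H p := by
  funext p
  simp [pd1, fderiv_fun_sub (hG p) (hH p)]

lemma pd2_sub (hG : Differentiable ℝ G) (hH : Differentiable ℝ H) :
    pd2 (fun p => G p - H p) = fun p => pd2 G p - pd2 H p := by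
  funext p
  simp [pd2, fderiv_fun_sub (hG p) (hH p)]

lemma lap_sub (hG : ContDiff ℝ 2 G) (hH : ContDiff ℝ 2 H) (q : ℝ × ℝ) :
    lap (fun p => G p - H p) q = lap G q - lap H q := by
  have h1 := (contDiff_pd1 hG).differentiable one_ne_zero
  have h2 := (contDiff_pd1 hH).differentiable one_ne_zero
  have h3 := (contDiff_pd2 hG).differentiable one_ne_zero
  have h4 := (contDiff_pd2 hH).differentiable one_ne_zero
  rw [lap, pd1_sub (hG.differentiable two_ne_zero) (hH.differentiable two_ne_zero),
    pd2_sub (hG.differentiable two_ne_zero) (hH.differentiable two_ne_zero),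
    pd1_sub h1 h2, pd2_sub h3 h4, lap, lap]
  ring

lemma pd1_comp_add (G : ℝ × ℝ → ℝ) (v : ℝ × ℝ) :
    pd1 (fun p => G (p + v)) = fun p => pd1 G (p + v) := by
  funext p
  simp only [pd1, fderiv_comp_add_right]

lemma pd2_comp_add (G : ℝ × ℝ → ℝ) (v : ℝ × ℝ) :
    pd2 (fun p => G (p + v)) = fun p => pd2 G (p + v) := by
  funext p
  simp only [pd2, fderiv_comp_add_right]

lemma lap_comp_add (G : ℝ × ℝ → ℝ) (v q : ℝ × ℝ) :
    lap (fun p => G (p + v)) q = lap G (q + v) := by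
  simp only [lap, pd1_comp_add, pd2_comp_add]

end PartialDerivatives

section LocalMinima

/-- The second derivative is nonnegative at a local minimum. -/
lemma IsLocalMin.deriv_deriv_nonneg {k : ℝ → ℝ} {t : ℝ} (hk : IsLocalMin k t)
    (hc : ContinuousAt k t) : 0 ≤ deriv (deriv k) t := by
  by_contra! hneg
  have hmax : IsLocalMax k t := isLocalMax_of_deriv_deriv_neg hneg hk.deriv_eq_zero hc
  have hconst : k =ᶠ[𝓝 t] fun _ => k t := by
    filter_upwards [hk, hmax] with s h1 h2 using le_antisymm h2 h1
  have h0 := hconst.deriv.deriv_eq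
  simp at h0
  exact hneg.ne h0

variable {G : ℝ × ℝ → ℝ} {q : ℝ × ℝ}

lemma IsLocalMin.pd2_eq_zero (hmin : IsLocalMin G q) : pd2 G q = 0 := by
  simp [pd2, hmin.fderiv_eq_zero]

lemma IsLocalMin.lap_nonneg (hG : ContDiff ℝ 2 G) (hmin : IsLocalMin G q) : 0 ≤ lap G q := by
  have hd := hG.differentiable two_ne_zero
  have h1 : deriv (fun s => G (s, q.2)) = fun s => pd1 G (s, q.2) :=
    funext fun s => (hasDerivAt_pd1 (q := (s, q.2)) (hd _)).deriv
  have h2 : deriv (fun s => G (q.1, s)) = fun s => pd2 G (q.1, s) :=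
    funext fun s => (hasDerivAt_pd2 (q := (q.1, s)) (hd _)).deriv
  have c1 : Continuous fun s : ℝ => (s, q.2) := by fun_prop
  have c2 : Continuous fun s : ℝ => (q.1, s) := by fun_prop
  have m1 : IsLocalMin (fun s => G (s, q.2)) q.1 :=
    IsMinFilter.comp_tendsto (g := fun s : ℝ => (s, q.2)) hmin (c1.tendsto q.1)
  have m2 : IsLocalMin (fun s => G (q.1, s)) q.2 :=
    IsMinFilter.comp_tendsto (g := fun s : ℝ => (q.1, s)) hmin (c2.tendsto q.2)
  have n1 := m1.deriv_deriv_nonneg (hG.continuous.comp c1).continuousAt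
  have n2 := m2.deriv_deriv_nonneg (hG.continuous.comp c2).continuousAt
  rw [h1, (hasDerivAt_pd1 (((contDiff_pd1 hG).differentiable one_ne_zero) q)).deriv] at n1
  rw [h2, (hasDerivAt_pd2 (((contDiff_pd2 hG).differentiable one_ne_zero) q)).deriv] at n2
  exact add_nonneg n1 n2

end LocalMinima

section StrongMaximumPrinciple

/-- `u` satisfies `Δu + f(y) ∂_y u ≤ C u` in the viscosity sense on `ℝ × (a, b)`. -/
def IsViscositySupersolution (f : ℝ → ℝ) (C a b : ℝ) (u : ℝ × ℝ → ℝ) : Prop :=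
  ∀ q : ℝ × ℝ, q.2 ∈ Ioo a b → ∀ φ : ℝ × ℝ → ℝ, ContDiff ℝ 2 φ →
    IsLocalMin (fun p => u p - φ p) q → lap φ q + f q.2 * pd2 φ q ≤ C * u q

/-- The squared Euclidean distance to `p`. -/
def sqDist (p q : ℝ × ℝ) : ℝ := (q.1 - p.1) ^ 2 + (q.2 - p.2) ^ 2

lemma contDiff_sqDist (p : ℝ × ℝ) : ContDiff ℝ 2 (sqDist p) := by
  unfold sqDist
  fun_prop

lemma abs_snd_sub_le_of_sqDist_le {p q : ℝ × ℝ} {R : ℝ} (hR : 0 ≤ R)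
    (h : sqDist p q ≤ R ^ 2) : |q.2 - p.2| ≤ R :=
  abs_le_of_sq_le_sq (by unfold sqDist at h; nlinarith [sq_nonneg (q.1 - p.1)]) hR

lemma abs_fst_sub_le_of_sqDist_le {p q : ℝ × ℝ} {R : ℝ} (hR : 0 ≤ R)
    (h : sqDist p q ≤ R ^ 2) : |q.1 - p.1| ≤ R :=
  abs_le_of_sq_le_sq (by unfold sqDist at h; nlinarith [sq_nonneg (q.2 - p.2)]) hR

lemma isCompact_sqDist_le (p : ℝ × ℝ) {R : ℝ} (hR : 0 ≤ R) :
    IsCompact {q | sqDist p q ≤ R ^ 2} := by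
  refine (isCompact_closedBall p R).of_isClosed_subset
    (isClosed_le (contDiff_sqDist p).continuous continuous_const) fun q hq => ?_
  rw [Metric.mem_closedBall, Prod.dist_eq, Real.dist_eq, Real.dist_eq]
  exact max_le (abs_fst_sub_le_of_sqDist_le hR hq) (abs_snd_sub_le_of_sqDist_le hR hq)

/-- The barrier `ε (exp (-α |q - p|²) - exp (-α R²))`. -/
noncomputable def barrier (p : ℝ × ℝ) (ε α R : ℝ) (q : ℝ × ℝ) : ℝ :=
  ε * (exp (-α * sqDist p q) - exp (-α * R ^ 2))

lemma contDiff_barrier (p : ℝ × ℝ) (ε α R : ℝ) : ContDiff ℝ 2 (barrier p ε α R) := by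
  have := contDiff_sqDist p
  unfold barrier
  fun_prop

lemma pd1_barrier (p : ℝ × ℝ) (ε α R : ℝ) :
    pd1 (barrier p ε α R) = fun q => -2 * α * ε * ((q.1 - p.1) * exp (-α * sqDist p q)) := by
  funext q
  refine (hasDerivAt_pd1 ((contDiff_barrier p ε α R).differentiable two_ne_zero q)).unique ?_
  have h1 : HasDerivAt (fun s : ℝ => sqDist p (s, q.2)) (2 * (q.1 - p.1)) q.1 := by
    simpa [sqDist] using (((hasDerivAt_id q.1).sub_const p.1).pow 2).add_const ((q.2 - p.2) ^ 2)
  refine ((((h1.const_mul (-α)).exp).sub_const (exp (-α * R ^ 2))).const_mul ε).congr_deriv ?_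
  ring

lemma pd2_barrier (p : ℝ × ℝ) (ε α R : ℝ) :
    pd2 (barrier p ε α R) = fun q => -2 * α * ε * ((q.2 - p.2) * exp (-α * sqDist p q)) := by
  funext q
  refine (hasDerivAt_pd2 ((contDiff_barrier p ε α R).differentiable two_ne_zero q)).unique ?_
  have h1 : HasDerivAt (fun s : ℝ => sqDist p (q.1, s)) (2 * (q.2 - p.2)) q.2 := by
    simpa [sqDist] using (((hasDerivAt_id q.2).sub_const p.2).pow 2).const_add ((q.1 - p.1) ^ 2)
  refine ((((h1.const_mul (-α)).exp).sub_const (exp (-α * R ^ 2))).const_mul ε).congr_deriv ?_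
  ring

lemma lap_barrier (p : ℝ × ℝ) (ε α R : ℝ) (q : ℝ × ℝ) :
    lap (barrier p ε α R) q
      = ε * exp (-α * sqDist p q) * (4 * α ^ 2 * sqDist p q - 4 * α) := by
  have hC := contDiff_barrier p ε α R
  have e1 : pd1 (pd1 (barrier p ε α R)) q
      = ε * exp (-α * sqDist p q) * (4 * α ^ 2 * (q.1 - p.1) ^ 2 - 2 * α) := by
    refine (hasDerivAt_pd1 ((contDiff_pd1 hC).differentiable one_ne_zero q)).unique ?_
    rw [pd1_barrier]
    have h1 : HasDerivAt (fun s : ℝ => sqDist p (s, q.2)) (2 * (q.1 - p.1)) q.1 := by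
      simpa [sqDist] using (((hasDerivAt_id q.1).sub_const p.1).pow 2).add_const ((q.2 - p.2) ^ 2)
    refine ((((hasDerivAt_id q.1).sub_const p.1).mul
      ((h1.const_mul (-α)).exp)).const_mul (-2 * α * ε)).congr_deriv ?_
    simp only [id]
    ring
  have e2 : pd2 (pd2 (barrier p ε α R)) q
      = ε * exp (-α * sqDist p q) * (4 * α ^ 2 * (q.2 - p.2) ^ 2 - 2 * α) := by
    refine (hasDerivAt_pd2 ((contDiff_pd2 hC).differentiable one_ne_zero q)).unique ?_
    rw [pd2_barrier]
    have h1 : HasDerivAt (fun s : ℝ => sqDist p (q.1, s)) (2 * (q.2 - p.2)) q.2 := by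
      simpa [sqDist] using (((hasDerivAt_id q.2).sub_const p.2).pow 2).const_add ((q.1 - p.1) ^ 2)
    refine ((((hasDerivAt_id q.2).sub_const p.2).mul
      ((h1.const_mul (-α)).exp)).const_mul (-2 * α * ε)).congr_deriv ?_
    simp only [id]
    ring
  rw [lap, e1, e2, sqDist]
  ring

variable {f : ℝ → ℝ} {C F a b : ℝ} {u : ℝ × ℝ → ℝ}

/-- Positivity on a small disc spreads to every larger concentric disc in the domain. -/
lemma IsViscositySupersolution.pos_of_pos_disc (hu : IsViscositySupersolution f C a b u)
    (hC : 0 ≤ C) (hF : ∀ y ∈ Ioo a b, |f y| ≤ F) (hcont : Continuous u)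
    (hnn : ∀ q : ℝ × ℝ, q.2 ∈ Ioo a b → 0 ≤ u q)
    {p : ℝ × ℝ} {r R : ℝ} (hr : 0 < r) (hrR : r < R) (ha : a < p.2 - R) (hb : p.2 + R < b)
    (hpos : ∀ q, sqDist p q ≤ r ^ 2 → 0 < u q) {q : ℝ × ℝ} (hq : sqDist p q < R ^ 2) :
    0 < u q := by
  have hR : 0 < R := hr.trans hrR
  have hF0 : 0 ≤ F := (abs_nonneg _).trans (hF p.2 ⟨by linarith, by linarith⟩)
  have hcD := (contDiff_sqDist p).continuous
  have hdom : ∀ q, sqDist p q ≤ R ^ 2 → q.2 ∈ Ioo a b := fun q hq => by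
    have := abs_le.1 (abs_snd_sub_le_of_sqDist_le hR.le hq)
    exact ⟨by linarith, by linarith⟩
  rcases le_or_gt (sqDist p q) (r ^ 2) with hqr | hqr
  · exact hpos q hqr
  obtain ⟨q₀, hq₀, hq₀min⟩ := (isCompact_sqDist_le p hr.le).exists_isMinOn
    ⟨p, by simp only [mem_ofPred_eq, sqDist]; nlinarith⟩ hcont.continuousOn
  set ε := u q₀ with hε
  have hε0 : 0 < ε := hpos q₀ hq₀
  obtain ⟨α, hα1, hα⟩ : ∃ α : ℝ, 1 ≤ α ∧ 0 < 4 * α ^ 2 * r ^ 2 - 4 * α - 2 * α * F * R - C := by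
    refine ⟨1 + (4 + 2 * F * R + C) / (4 * r ^ 2), ?_, ?_⟩
    · have : 0 ≤ (4 + 2 * F * R + C) / (4 * r ^ 2) := by positivity
      linarith
    · set t := (4 + 2 * F * R + C) / (4 * r ^ 2) with ht
      have ht0 : 0 ≤ t := by positivity
      have e : 4 * r ^ 2 * t = 4 + 2 * F * R + C := by rw [ht]; field_simp
      have : 4 * (1 + t) ^ 2 * r ^ 2 - 4 * (1 + t) - 2 * (1 + t) * F * R - C
          = (1 + t) * (4 * r ^ 2 + (4 * r ^ 2 * t - (4 + 2 * F * R + C))) + t * C := by ring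
      rw [this, e]
      have : 0 ≤ t * C := by positivity
      have : 0 < (1 + t) * (4 * r ^ 2) := by positivity
      linarith
  have hα0 : 0 < α := by linarith
  set v := barrier p ε α R with hv
  have hvC : ContDiff ℝ 2 v := contDiff_barrier p ε α R
  have hvlt : ∀ q, v q < ε * exp (-α * sqDist p q) := fun q => by
    rw [hv, barrier]
    nlinarith [exp_pos (-α * R ^ 2)]
  have hkey : ∀ q, r ^ 2 ≤ sqDist p q → sqDist p q ≤ R ^ 2 → v q ≤ u q := by
    by_contra! hcon
    obtain ⟨q₁, h1, h2, h3⟩ := hcon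
    obtain ⟨z, ⟨hz1, hz2⟩, hzmin⟩ :=
      ((isCompact_sqDist_le p hR.le).inter_left
        (isClosed_le continuous_const hcD : IsClosed {q | r ^ 2 ≤ sqDist p q})).exists_isMinOn
        ⟨q₁, h1, h2⟩ (hcont.sub hvC.continuous).continuousOn
    simp only [mem_ofPred_eq] at hz1 hz2
    have hzneg : u z < v z := by
      have : u z - v z ≤ u q₁ - v q₁ := hzmin ⟨h1, h2⟩
      linarith
    have hz1' : r ^ 2 < sqDist p z := by
      refine lt_of_le_of_ne hz1 fun heq => ?_
      have h4 : ε ≤ u z := hq₀min heq.ge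
      have h5 : exp (-α * sqDist p z) ≤ 1 :=
        exp_le_one_iff.2 (by nlinarith [sq_nonneg r])
      nlinarith [hvlt z]
    have hz2' : sqDist p z < R ^ 2 := by
      refine lt_of_le_of_ne hz2 fun heq => ?_
      have h4 : v z = 0 := by rw [hv, barrier, heq, sub_self, mul_zero]
      linarith [hnn z (hdom z hz2)]
    have hloc : IsLocalMin (fun p => u p - v p) z := by
      filter_upwards [hcD.continuousAt.eventually_const_lt hz1',
        hcD.continuousAt.eventually_lt_const hz2'] with w hw1 hw2
      exact hzmin ⟨hw1.le, hw2.le⟩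
    have hvis := hu z (hdom z hz2) v hvC hloc
    rw [lap_barrier, pd2_barrier] at hvis
    set E := exp (-α * sqDist p z) with hE
    have hE0 : 0 < ε * E := mul_pos hε0 (exp_pos _)
    have h6 : f z.2 * (z.2 - p.2) ≤ F * R := by
      refine (le_abs_self _).trans ?_
      rw [abs_mul]
      exact mul_le_mul (hF _ (hdom z hz2)) (abs_snd_sub_le_of_sqDist_le hR.le hz2)
        (abs_nonneg _) hF0
    have h7 : C * u z ≤ C * (ε * E) :=
      mul_le_mul_of_nonneg_left (hzneg.trans (hvlt z)).le hC
    have h8 : 0 < 4 * α ^ 2 * sqDist p z - 4 * α - 2 * α * (f z.2 * (z.2 - p.2)) - C := by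
      have h9 : α ^ 2 * r ^ 2 ≤ α ^ 2 * sqDist p z := by gcongr
      have h10 : α * (f z.2 * (z.2 - p.2)) ≤ α * (F * R) := by gcongr
      linarith
    have h11 := mul_pos hE0 h8
    linarith
  refine lt_of_lt_of_le ?_ (hkey q hqr.le hq.le)
  rw [hv, barrier]
  refine mul_pos hε0 (sub_pos.2 (exp_lt_exp.2 ?_))
  nlinarith

/-- The strong maximum principle for viscosity supersolutions on a strip. -/
theorem IsViscositySupersolution.pos (hu : IsViscositySupersolution f C a b u)
    (hC : 0 ≤ C) (hF : ∀ y ∈ Ioo a b, |f y| ≤ F) (hcont : Continuous u)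
    (hnn : ∀ q : ℝ × ℝ, q.2 ∈ Ioo a b → 0 ≤ u q)
    {p₀ : ℝ × ℝ} (hp₀ : p₀.2 ∈ Ioo a b) (hpos : 0 < u p₀) {q : ℝ × ℝ} (hq : q.2 ∈ Ioo a b) :
    0 < u q := by
  have hopen : IsOpen {p : ℝ × ℝ | p.2 ∈ Ioo a b ∧ 0 < u p} :=
    (isOpen_Ioo.preimage continuous_snd).inter (isOpen_lt continuous_const hcont)
  have hconn : IsPreconnected {p : ℝ × ℝ | p.2 ∈ Ioo a b} :=
    ((convex_Ioo a b).linear_preimage (LinearMap.snd ℝ ℝ ℝ)).isPreconnected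
  refine (hconn.subset_of_closure_inter_subset hopen ⟨p₀, hp₀, hp₀, hpos⟩ ?_ hq).2
  rintro z ⟨hzc, hz⟩
  refine ⟨hz, ?_⟩
  set R := min (z.2 - a) (b - z.2) / 2 with hR
  have hR0 : 0 < R := half_pos (lt_min (sub_pos.2 hz.1) (sub_pos.2 hz.2))
  have hRa : 2 * R ≤ z.2 - a := by rw [hR]; linarith [min_le_left (z.2 - a) (b - z.2)]
  have hRb : 2 * R ≤ b - z.2 := by rw [hR]; linarith [min_le_right (z.2 - a) (b - z.2)]
  obtain ⟨p, ⟨hp, hup⟩, hdist⟩ := Metric.mem_closure_iff.1 hzc (R / 2) (half_pos hR0)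
  rw [Prod.dist_eq, max_lt_iff, Real.dist_eq, Real.dist_eq, abs_lt, abs_lt] at hdist
  obtain ⟨⟨d1, d2⟩, d3, d4⟩ := hdist
  obtain ⟨r, hr, hball⟩ := Metric.eventually_nhds_iff.1
    (hcont.continuousAt.eventually_const_lt hup)
  have hr' : 0 < min (r / 2) (R / 2) := by positivity
  refine hu.pos_of_pos_disc hC hF hcont hnn (p := p) (R := R) hr'
    ((min_le_right _ _).trans_lt (half_lt_self hR0)) (by linarith) (by linarith) (fun w hw => ?_) ?_
  · apply hball
    rw [Prod.dist_eq, Real.dist_eq, Real.dist_eq]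
    refine (max_le (abs_fst_sub_le_of_sqDist_le hr'.le hw)
      (abs_snd_sub_le_of_sqDist_le hr'.le hw)).trans_lt ?_
    exact (min_le_left _ _).trans_lt (half_lt_self hr)
  · unfold sqDist
    nlinarith

end StrongMaximumPrinciple

section Comparison

variable {f : ℝ → ℝ} {g : ℝ × ℝ → ℝ} {h : ℝ → ℝ} {ψ φ : ℝ × ℝ → ℝ} {Kg Kh : ℝ}
  {q q' : ℝ × ℝ}

/-- The difference inequality for two points of the strip, the second one being higher. -/
lemma lap_add_mul_pd2_le
    (hg : ∀ y s s', |g (y, s) - g (y, s')| ≤ Kg * |s - s'|)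
    (hh : ∀ s s', |h s - h s'| ≤ Kh * |s - s'|)
    (hfmono : MonotoneOn f (Icc (1 / 2 : ℝ) 1))
    (hgmono : ∀ s : ℝ, MonotoneOn (fun y => g (y, s)) (Icc (1 / 2 : ℝ) 1))
    (heq : ∀ q ∈ strip, lap ψ q + f q.2 * pd2 ψ q + g (q.2, ψ q) + h (ψ q) = 0)
    (hq : q ∈ strip) (hq' : q' ∈ strip) (hle : q.2 ≤ q'.2) (hmono : 0 ≤ pd2 ψ q')
    (hlap : lap φ q ≤ lap ψ q' - lap ψ q) (hpd : pd2 φ q = pd2 ψ q' - pd2 ψ q) :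
    lap φ q + f q.2 * pd2 φ q ≤ (Kg + Kh) * |ψ q' - ψ q| := by
  have e := heq q hq
  have e' := heq q' hq'
  have h1 : 0 ≤ (f q'.2 - f q.2) * pd2 ψ q' :=
    mul_nonneg (sub_nonneg.2 (hfmono hq hq' hle)) hmono
  have h2 : g (q.2, ψ q') ≤ g (q'.2, ψ q') := hgmono (ψ q') hq hq' hle
  have h3 := (abs_le.1 (hg q.2 (ψ q') (ψ q))).1
  have h4 := (abs_le.1 (hh (ψ q') (ψ q))).1
  rw [hpd]
  linarith

lemma lap_le_of_isLocalMin_translate (hψ : ContDiff ℝ 2 ψ) (hφ : ContDiff ℝ 2 φ)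
    (hmin : IsLocalMin (fun p => ψ (p + (q' - q)) - ψ p - φ p) q) :
    lap φ q ≤ lap ψ q' - lap ψ q ∧ pd2 φ q = pd2 ψ q' - pd2 ψ q := by
  have hT : ContDiff ℝ 2 fun p => ψ (p + (q' - q)) := by fun_prop
  have hD := hT.sub hψ
  have h1 := hmin.lap_nonneg (hD.sub hφ)
  have h2 := hmin.pd2_eq_zero
  rw [lap_sub hD hφ, lap_sub hT hψ, lap_comp_add, add_sub_cancel] at h1
  rw [pd2_sub (hD.differentiable two_ne_zero) (hφ.differentiable two_ne_zero),
    pd2_sub (hT.differentiable two_ne_zero) (hψ.differentiable two_ne_zero),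
    pd2_comp_add] at h2
  simp only [add_sub_cancel] at h2
  exact ⟨by linarith, by linarith⟩

lemma lap_le_of_isLocalMin_const (k : ℝ) (hψ : ContDiff ℝ 2 ψ) (hφ : ContDiff ℝ 2 φ)
    (hmin : IsLocalMin (fun p => k - ψ p - φ p) q) :
    lap φ q ≤ -lap ψ q ∧ pd2 φ q = -pd2 ψ q := by
  have hT : ContDiff ℝ 2 fun _ : ℝ × ℝ => k := contDiff_const
  have hD := hT.sub hψ
  have e1 : pd1 (fun _ => k) = fun _ => 0 := by funext p; simp [pd1]
  have e2 : pd2 (fun _ => k) = fun _ => 0 := by funext p; simp [pd2]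
  have e3 : lap (fun _ => k) q = 0 := by simp [lap, e1, e2, pd1, pd2]
  have h1 := hmin.lap_nonneg (hD.sub hφ)
  have h2 := hmin.pd2_eq_zero
  rw [lap_sub hD hφ, lap_sub hT hψ, e3] at h1
  rw [pd2_sub (hD.differentiable two_ne_zero) (hφ.differentiable two_ne_zero),
    pd2_sub (hT.differentiable two_ne_zero) (hψ.differentiable two_ne_zero), e2] at h2
  exact ⟨by linarith, by linarith⟩

lemma pd2_nonneg_of_forall_le (hψ : Differentiable ℝ ψ) {x z : ℝ} (hz : z < 1)
    (hmin : ∀ z' ∈ Icc z 1, ψ (x, z) ≤ ψ (x, z')) : 0 ≤ pd2 ψ (x, z) := by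
  have hd := (hasDerivAt_pd2 (hψ (x, z))).hasDerivWithinAt (s := Ioi z)
  rw [hasDerivWithinAt_iff_tendsto_slope' self_notMem_Ioi] at hd
  refine ge_of_tendsto hd ?_
  filter_upwards [Ioo_mem_nhdsGT hz] with s hs
  rw [slope_def_field]
  exact div_nonneg (sub_nonneg.2 (hmin s ⟨hs.1.le, hs.2.le⟩)) (sub_nonneg.2 hs.1.le)

end Comparison

section UpperMinimum

/-- The minimum of `ψ` over the part of the strip above height `t`. -/
noncomputable def upperMin (ψ : ℝ × ℝ → ℝ) (t : ℝ) : ℝ :=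
  sInf ((fun k : ℝ × ℝ => ψ (k.1, max k.2 t)) '' (Icc 0 (2 * π) ×ˢ Icc (1 / 2) 1))

variable {ψ : ℝ × ℝ → ℝ}

lemma exists_mem_Icc_forall_eq (hper : ∀ q : ℝ × ℝ, ψ (q.1 + 2 * π, q.2) = ψ q) (x : ℝ) :
    ∃ x₁ ∈ Icc 0 (2 * π), ∀ y, ψ (x, y) = ψ (x₁, y) := by
  have hp : Function.Periodic (fun x y => ψ (x, y)) (2 * π) := fun x => funext fun y => hper (x, y)
  obtain ⟨x₁, hx₁, he⟩ := hp.exists_mem_Ico₀ two_pi_pos x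
  exact ⟨x₁, Ico_subset_Icc_self hx₁, congrFun he⟩

lemma isCompact_cell : IsCompact (Icc 0 (2 * π) ×ˢ Icc (1 / 2 : ℝ) 1) :=
  isCompact_Icc.prod isCompact_Icc

lemma continuous_upperMin (hψ : Continuous ψ) : Continuous (upperMin ψ) := by
  refine isCompact_cell.continuous_sInf (f := fun t (k : ℝ × ℝ) => ψ (k.1, max k.2 t)) ?_
  simp only [Function.HasUncurry.uncurry, id]
  fun_prop

lemma upperMin_le (hψ : Continuous ψ) (hper : ∀ q : ℝ × ℝ, ψ (q.1 + 2 * π, q.2) = ψ q)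
    {t x z : ℝ} (htz : t ≤ z) (hz : z ∈ Icc (1 / 2 : ℝ) 1) : upperMin ψ t ≤ ψ (x, z) := by
  obtain ⟨x₁, hx₁, he⟩ := exists_mem_Icc_forall_eq hper x
  rw [he]
  have hc : Continuous fun k : ℝ × ℝ => ψ (k.1, max k.2 t) := by fun_prop
  refine csInf_le (isCompact_cell.image hc).bddBelow ⟨(x₁, z), ⟨hx₁, hz⟩, ?_⟩
  simp only [max_eq_left htz]

lemma exists_upperMin_eq (hψ : Continuous ψ) {t : ℝ} (ht : t ≤ 1) :
    ∃ x z, t ≤ z ∧ z ∈ Icc (1 / 2 : ℝ) 1 ∧ upperMin ψ t = ψ (x, z) := by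
  have hc : Continuous fun k : ℝ × ℝ => ψ (k.1, max k.2 t) := by fun_prop
  obtain ⟨⟨x, ζ⟩, ⟨-, hζ⟩, he⟩ := (isCompact_cell.image hc).sInf_mem
    (Nonempty.image _ ⟨(0, 1), ⟨le_rfl, two_pi_pos.le⟩, by norm_num, le_rfl⟩)
  exact ⟨x, max ζ t, le_max_right _ _, ⟨hζ.1.trans (le_max_left _ _), max_le hζ.2 ht⟩, he.symm⟩

end UpperMinimum

section Sliding

variable {f : ℝ → ℝ} {g : ℝ × ℝ → ℝ} {h : ℝ → ℝ} {ψ : ℝ × ℝ → ℝ} {c Kg Kh F : ℝ}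

/-- If `ψ` is nondecreasing in `y`, then it is strictly increasing in `y`. -/
lemma strictMonoOn_of_pd2_nonneg
    (hg : ∀ y s s', |g (y, s) - g (y, s')| ≤ Kg * |s - s'|)
    (hh : ∀ s s', |h s - h s'| ≤ Kh * |s - s'|) (hK : 0 ≤ Kg + Kh)
    (hF : ∀ y ∈ Icc (1 / 2 : ℝ) 1, |f y| ≤ F)
    (hfmono : MonotoneOn f (Icc (1 / 2 : ℝ) 1))
    (hgmono : ∀ s : ℝ, MonotoneOn (fun y => g (y, s)) (Icc (1 / 2 : ℝ) 1))
    (hψ : ContDiff ℝ 2 ψ)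
    (hc : 0 < c)
    (heq : ∀ q ∈ strip, lap ψ q + f q.2 * pd2 ψ q + g (q.2, ψ q) + h (ψ q) = 0)
    (hbot : ∀ x : ℝ, ψ (x, 1 / 2) = 0) (htop : ∀ x : ℝ, ψ (x, 1) = c)
    (hmono : ∀ q ∈ strip, 0 ≤ pd2 ψ q) (x : ℝ) :
    StrictMonoOn (fun y => ψ (x, y)) (Icc (1 / 2 : ℝ) 1) := by
  have hd := hψ.differentiable two_ne_zero
  have hψc := hψ.continuous
  have hm : ∀ x, MonotoneOn (fun y => ψ (x, y)) (Icc (1 / 2 : ℝ) 1) := fun x => by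
    refine monotoneOn_of_deriv_nonneg (convex_Icc _ _) (by fun_prop)
      (fun y _ => (hasDerivAt_pd2 (q := (x, y)) (hd _)).differentiableAt.differentiableWithinAt)
      fun y hy => ?_
    rw [(hasDerivAt_pd2 (q := (x, y)) (hd _)).deriv]
    exact hmono (x, y) (show y ∈ Icc (1 / 2 : ℝ) 1 from interior_subset hy)
  intro y₁ hy₁ y₂ hy₂ hlt
  by_contra! hle
  obtain ⟨n, hn⟩ := exists_nat_one_div_lt (half_pos (sub_pos.2 hlt))
  set τ : ℝ := 1 / (2 * (n + 1)) with hτ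
  have hτ0 : 0 < τ := by positivity
  have hτn : 1 / ((n : ℝ) + 1) = 2 * τ := by rw [hτ]; field_simp
  have hτ1 : ((n : ℝ) + 1) * τ = 1 / 2 := by rw [hτ]; field_simp
  set u : ℝ × ℝ → ℝ := fun p => ψ (p + (0, τ)) - ψ p with hu
  have huc : Continuous u := by fun_prop
  have hnn : ∀ q : ℝ × ℝ, q.2 ∈ Ioo (1 / 2) (1 - τ) → 0 ≤ u q := fun q hq => by
    have := hm q.1 (a := q.2) (b := q.2 + τ) ⟨hq.1.le, by linarith [hq.2]⟩
      ⟨by linarith [hq.1], by linarith [hq.2]⟩ (by linarith)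
    simpa [hu, Prod.add_def] using this
  have hvis : IsViscositySupersolution f (Kg + Kh) (1 / 2) (1 - τ) u := fun q hq φ hφ hmin => by
    have hqs : q ∈ strip := ⟨hq.1.le, by linarith [hq.2]⟩
    have hqs' : q + (0, τ) ∈ strip :=
      ⟨by simp only [Prod.snd_add]; linarith [hq.1], by simp only [Prod.snd_add]; linarith [hq.2]⟩
    have hL := lap_le_of_isLocalMin_translate (q := q) (q' := q + (0, τ)) hψ hφ
      (by simpa [hu] using hmin)
    rw [← abs_of_nonneg (hnn q hq)]
    exact lap_add_mul_pd2_le hg hh hfmono hgmono heq hqs hqs' (by simp [hτ0.le])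
      (hmono _ hqs') hL.1 hL.2
  have hzero : ∀ q : ℝ × ℝ, q.2 ∈ Ioo (1 / 2) (1 - τ) → u q = 0 := by
    by_contra! hcon
    obtain ⟨p₀, hp₀, hne⟩ := hcon
    have hpos := hvis.pos hK (fun y hy => hF y ⟨hy.1.le, by linarith [hy.2]⟩) huc hnn hp₀
      ((hnn p₀ hp₀).lt_of_ne' hne) (q := (x, (y₁ + (y₂ - τ)) / 2))
      ⟨by linarith [hy₁.1], by linarith [hy₂.2]⟩
    simp only [hu, Prod.mk_add_mk, add_zero] at hpos
    have h1 := hm x hy₁ (b := (y₁ + (y₂ - τ)) / 2)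
      ⟨by linarith [hy₁.1], by linarith [hy₂.2]⟩ (by linarith)
    have h2 := hm x (a := (y₁ + (y₂ - τ)) / 2 + τ)
      ⟨by linarith [hy₁.1], by linarith [hy₂.2]⟩ hy₂ (by linarith)
    simp only at h1 h2
    linarith
  have hτlt : (1 / 2 : ℝ) < 1 - τ := by linarith [hy₁.1, hy₂.2]
  have hzero' : ∀ y ∈ Icc (1 / 2) (1 - τ), ψ (0, y + τ) = ψ (0, y) := by
    have hcl : IsClosed {y : ℝ | ψ (0, y + τ) = ψ (0, y)} :=
      isClosed_eq (by fun_prop) (by fun_prop)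
    rw [← closure_Ioo hτlt.ne]
    refine hcl.closure_subset_iff.2 fun y hy => ?_
    simpa [hu, sub_eq_zero] using hzero (0, y) hy
  have hind : ∀ k : ℕ, k ≤ n + 1 → ψ (0, 1 / 2 + k * τ) = 0 := by
    intro k
    induction k with
    | zero => intro _; simpa using hbot 0
    | succ k ih =>
      intro hk
      have hk' : (k : ℝ) ≤ n := by exact_mod_cast Nat.le_of_succ_le_succ hk
      have hkτ : (k : ℝ) * τ ≤ n * τ := by gcongr
      have := hzero' (1 / 2 + k * τ) ⟨by linarith [show 0 ≤ (k : ℝ) * τ by positivity],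
        by linarith⟩
      rw [ih (by omega)] at this
      rw [show 1 / 2 + ((k + 1 : ℕ) : ℝ) * τ = 1 / 2 + k * τ + τ by push_cast; ring]
      exact this
  have hlast := hind (n + 1) le_rfl
  push_cast at hlast
  rw [hτ1, show (1 / 2 + 1 / 2 : ℝ) = 1 by norm_num, htop] at hlast
  exact hc.ne' hlast

/-- If `0 < ψ < c` inside the strip, then any two values of `ψ` at the same height are ordered. -/
lemma le_of_mem_Ioo
    (hg : ∀ y s s', |g (y, s) - g (y, s')| ≤ Kg * |s - s'|)
    (hh : ∀ s s', |h s - h s'| ≤ Kh * |s - s'|) (hK : 0 ≤ Kg + Kh)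
    (hF : ∀ y ∈ Icc (1 / 2 : ℝ) 1, |f y| ≤ F)
    (hfmono : MonotoneOn f (Icc (1 / 2 : ℝ) 1))
    (hgmono : ∀ s : ℝ, MonotoneOn (fun y => g (y, s)) (Icc (1 / 2 : ℝ) 1))
    (hψ : ContDiff ℝ 2 ψ)
    (hper : ∀ q : ℝ × ℝ, ψ (q.1 + 2 * π, q.2) = ψ q)
    (hc : 0 < c)
    (heq : ∀ q ∈ strip, lap ψ q + f q.2 * pd2 ψ q + g (q.2, ψ q) + h (ψ q) = 0)
    (hbot : ∀ x : ℝ, ψ (x, 1 / 2) = 0) (htop : ∀ x : ℝ, ψ (x, 1) = c)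
    (hint : ∀ q : ℝ × ℝ, q.2 ∈ Ioo (1 / 2 : ℝ) 1 → 0 < ψ q ∧ ψ q < c)
    {y : ℝ} (hy : y ∈ Icc (1 / 2 : ℝ) 1) (x x' : ℝ) : ψ (x, y) ≤ ψ (x', y) := by
  have hd := hψ.differentiable two_ne_zero
  have hψc := hψ.continuous
  have hpos : ∀ x y, 1 / 2 < y → y ≤ 1 → 0 < ψ (x, y) := fun x y h1 h2 => by
    rcases h2.eq_or_lt with rfl | h2
    · rwa [htop]
    · exact (hint (x, y) ⟨h1, h2⟩).1
  have hltc : ∀ x y, 1 / 2 ≤ y → y < 1 → ψ (x, y) < c := fun x y h1 h2 => by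
    rcases h1.eq_or_lt with rfl | h1
    · rwa [hbot]
    · exact (hint (x, y) ⟨h1, h2⟩).2
  by_contra! hcon
  -- a contact pair `(x₁, y₁)`, `(x₂, y₂)` of maximal vertical separation
  set B : Set ((ℝ × ℝ) × (ℝ × ℝ)) :=
    ((Icc 0 (2 * π) ×ˢ Icc (1 / 2 : ℝ) 1) ×ˢ (Icc 0 (2 * π) ×ˢ Icc (1 / 2 : ℝ) 1)) ∩
      {k | ψ k.2 ≤ ψ k.1}
  have hBc : IsCompact B := (isCompact_cell.prod isCompact_cell).inter_right
    (isClosed_le (by fun_prop) (by fun_prop))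
  have hmemB : ∀ {x y x' z : ℝ}, y ∈ Icc (1 / 2 : ℝ) 1 → z ∈ Icc (1 / 2 : ℝ) 1 →
      ψ (x', z) ≤ ψ (x, y) → ∃ a a', ((a, y), (a', z)) ∈ B := by
    intro x y x' z hy hz hle
    obtain ⟨a, ha, hae⟩ := exists_mem_Icc_forall_eq hper x
    obtain ⟨a', ha', hae'⟩ := exists_mem_Icc_forall_eq hper x'
    refine ⟨a, a', ⟨⟨ha, hy⟩, ha', hz⟩, ?_⟩
    simpa only [mem_ofPred_eq, ← hae, ← hae'] using hle
  have hy1 : y < 1 := by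
    refine hy.2.lt_of_ne fun he => ?_
    rw [he, htop, htop] at hcon
    exact lt_irrefl _ hcon
  obtain ⟨z, hzψ, hyz, hz1⟩ : ∃ z, ψ (x', z) < ψ (x, y) ∧ y < z ∧ z < 1 := by
    have hcc : Continuous fun z => ψ (x', z) := by fun_prop
    have h1 := (hcc.continuousAt.eventually_lt_const hcon).filter_mono
      (nhdsWithin_le_nhds (a := y) (s := Ioi y))
    obtain ⟨z, h2, h3⟩ := (h1.and (Ioo_mem_nhdsGT hy1)).exists
    exact ⟨z, h2, h3.1, h3.2⟩
  obtain ⟨a, a', hab⟩ := hmemB hy ⟨hy.1.trans hyz.le, hz1.le⟩ hzψ.le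
  obtain ⟨⟨⟨x₁, y₁⟩, x₂, y₂⟩, ⟨⟨⟨-, hy₁⟩, -, hy₂⟩, hle⟩, hmax⟩ :=
    hBc.exists_isMaxOn ⟨_, hab⟩
      (by fun_prop : Continuous fun k : (ℝ × ℝ) × (ℝ × ℝ) => k.2.2 - k.1.2).continuousOn
  simp only [mem_ofPred_eq] at hy₁ hy₂ hle
  set τ := y₂ - y₁ with hτ
  have hτ0 : 0 < τ := by
    have : z - y ≤ y₂ - y₁ := hmax hab
    linarith
  have hy₁' : 1 / 2 < y₁ := by
    refine hy₁.1.lt_of_ne fun he => ?_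
    rw [← he, hbot] at hle
    exact hle.not_gt (hpos x₂ y₂ (by linarith) hy₂.2)
  have hy₂' : y₂ < 1 := by
    refine hy₂.2.lt_of_ne fun he => ?_
    rw [he, htop] at hle
    exact hle.not_gt (hltc x₁ y₁ hy₁.1 (by linarith))
  have hcmp : ∀ x y x' z, y ∈ Icc (1 / 2 : ℝ) 1 → z ∈ Icc (1 / 2 : ℝ) 1 → y + τ < z →
      ψ (x, y) < ψ (x', z) := by
    intro x y x' z hy hz hyz
    by_contra! hle
    obtain ⟨a, a', hab⟩ := hmemB hy hz hle
    have : z - y ≤ y₂ - y₁ := hmax hab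
    linarith
  have hcmp' : ∀ x y x' z, y ∈ Icc (1 / 2 : ℝ) 1 → z ∈ Icc (1 / 2 : ℝ) 1 → y + τ ≤ z →
      ψ (x, y) ≤ ψ (x', z) := by
    intro x y x' z hy hz hyz
    rcases hz.2.eq_or_lt with rfl | hz1
    · rw [htop]
      exact (hltc x y hy.1 (by linarith)).le
    · have hcc : Continuous fun z => ψ (x', z) := by fun_prop
      refine ge_of_tendsto (hcc.continuousAt.mono_left nhdsWithin_le_nhds :
        Tendsto _ (𝓝[>] z) _) ?_
      filter_upwards [Ioo_mem_nhdsGT hz1] with s hs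
      exact (hcmp x y x' s hy ⟨hz.1.trans hs.1.le, hs.2.le⟩ (hyz.trans_lt hs.1)).le
  set u : ℝ × ℝ → ℝ := fun p => upperMin ψ (p.2 + τ) - ψ p with hu
  have huc : Continuous u := by
    have := continuous_upperMin hψc
    fun_prop
  have hnn : ∀ q : ℝ × ℝ, q.2 ∈ Ioo (1 / 2) (1 - τ) → 0 ≤ u q := fun q hq => by
    obtain ⟨a, z, h1, h2, h3⟩ := exists_upperMin_eq hψc (t := q.2 + τ) (by linarith [hq.2])
    have := hcmp' q.1 q.2 a z ⟨hq.1.le, by linarith [hq.2]⟩ h2 h1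
    simp only [hu, h3]
    exact sub_nonneg.2 this
  have hvis : IsViscositySupersolution f (Kg + Kh) (1 / 2) (1 - τ) u := fun q hq φ hφ hmin => by
    obtain ⟨a, z, h1, h2, h3⟩ := exists_upperMin_eq hψc (t := q.2 + τ) (by linarith [hq.2])
    have hqs : q ∈ strip := ⟨hq.1.le, by linarith [hq.2]⟩
    have hqs' : (a, z) ∈ strip := h2
    have huq : u q = |ψ (a, z) - ψ q| := by
      rw [← h3]
      exact (abs_of_nonneg (hnn q hq)).symm
    have hz1 : z < 1 := by
      refine h2.2.lt_of_ne fun he => ?_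
      have h4 := upperMin_le hψc hper (x := 0) (le_refl (q.2 + τ))
        ⟨by linarith [hq.1], by linarith [hq.2]⟩
      rw [h3, he, htop] at h4
      exact h4.not_gt (hltc 0 (q.2 + τ) (by linarith [hq.1]) (by linarith [hq.2]))
    have hstrip : ∀ᶠ p : ℝ × ℝ in 𝓝 q, p.2 ∈ Ioo (1 / 2) (1 - τ) :=
      continuous_snd.continuousAt.eventually_mem (isOpen_Ioo.mem_nhds hq)
    rw [huq]
    rcases h1.eq_or_lt with hzq | hzq
    · have hL : IsLocalMin (fun p => ψ (p + ((a, z) - q)) - ψ p - φ p) q := by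
        filter_upwards [hmin, hstrip] with p hp hps
        have h4 : upperMin ψ (p.2 + τ) ≤ ψ (p + ((a, z) - q)) :=
          upperMin_le hψc hper (x := p.1 + (a - q.1)) (z := p.2 + (z - q.2))
            (by linarith) ⟨by linarith [hps.1], by linarith [hps.2]⟩
        simp only [hu] at hp
        rw [add_sub_cancel, ← h3]
        linarith
      have hL' := lap_le_of_isLocalMin_translate hψ hφ hL
      refine lap_add_mul_pd2_le hg hh hfmono hgmono heq hqs hqs' (by simp only; linarith) ?_
        hL'.1 hL'.2
      refine pd2_nonneg_of_forall_le hd hz1 fun z' hz' => ?_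
      rw [← h3]
      exact upperMin_le hψc hper (by linarith [hz'.1]) ⟨h2.1.trans hz'.1, hz'.2⟩
    · have hM : IsLocalMin ψ (a, z) := by
        have hev : ∀ᶠ p : ℝ × ℝ in 𝓝 (a, z), p.2 ∈ Ioo (q.2 + τ) 1 :=
          continuous_snd.continuousAt.eventually_mem (isOpen_Ioo.mem_nhds ⟨hzq, hz1⟩)
        filter_upwards [hev] with p hp
        rw [← h3]
        exact upperMin_le hψc hper (x := p.1) hp.1.le ⟨by linarith [hp.1, hq.1], hp.2.le⟩
      have hL : IsLocalMin (fun p => ψ (a, z) - ψ p - φ p) q := by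
        have hev : ∀ᶠ p : ℝ × ℝ in 𝓝 q, p.2 < z - τ :=
          continuous_snd.continuousAt.eventually_lt_const (by linarith)
        filter_upwards [hmin, hev] with p hp hpz
        have h4 : upperMin ψ (p.2 + τ) ≤ ψ (a, z) :=
          upperMin_le hψc hper (by linarith) h2
        simp only [hu] at hp
        linarith
      have hL' := lap_le_of_isLocalMin_const _ hψ hφ hL
      have h5 := hM.lap_nonneg hψ
      have h6 := hM.pd2_eq_zero
      exact lap_add_mul_pd2_le hg hh hfmono hgmono heq hqs hqs' (by simp only; linarith) h6.ge
        (by linarith) (by linarith)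
  have hbase : 0 < u (0, 1 / 2) := by
    obtain ⟨a, z, h1, h2, h3⟩ := exists_upperMin_eq hψc (t := 1 / 2 + τ) (by linarith)
    simp only [hu, hbot, h3, sub_zero]
    exact hpos a z (by linarith) h2.2
  obtain ⟨s, hs, hsI⟩ : ∃ s, 0 < u (0, s) ∧ s ∈ Ioo (1 / 2) (1 - τ) := by
    have hcc : Continuous fun s => u (0, s) := by fun_prop
    have h1 := (hcc.continuousAt.eventually_const_lt hbase).filter_mono
      (nhdsWithin_le_nhds (a := (1 / 2 : ℝ)) (s := Ioi (1 / 2)))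
    exact (h1.and (Ioo_mem_nhdsGT (by linarith))).exists
  have hcontact := hvis.pos hK (fun y hy => hF y ⟨hy.1.le, by linarith [hy.2]⟩) huc hnn
    (p₀ := (0, s)) hsI hs (q := (x₁, y₁)) ⟨hy₁', by simp only; linarith⟩
  have := upperMin_le hψc hper (x := x₂) (t := y₁ + τ) (z := y₂) (by linarith) hy₂
  simp only [hu] at hcontact
  linarith

end Sliding

/-- Liouville theorem for a semilinear elliptic equation on the periodic strip:
a `C²` periodic solution `ψ` of `Δψ + f(y) ∂_y ψ + g(y,ψ) + h(ψ) = 0` with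
boundary values `0` and `c > 0` must be independent of `x`, provided `f` and
`g(·,s)` are nondecreasing and either `0 < ψ < c` in the interior or
`∂_y ψ ≥ 0`. -/
theorem liouville_strip
    (f : ℝ → ℝ) (g : ℝ × ℝ → ℝ) (h : ℝ → ℝ)
    (hf : ∃ K, LipschitzWith K f) (hg : ∃ K, LipschitzWith K g)
    (hh : ∃ K, LipschitzWith K h)
    (hfmono : MonotoneOn f (Set.Icc (1 / 2 : ℝ) 1))
    (hgmono : ∀ s : ℝ, MonotoneOn (fun y => g (y, s)) (Set.Icc (1 / 2 : ℝ) 1))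
    (ψ : ℝ × ℝ → ℝ) (hψ : ContDiff ℝ 2 ψ)
    (hper : ∀ q : ℝ × ℝ, ψ (q.1 + 2 * π, q.2) = ψ q)
    (c : ℝ) (hc : 0 < c)
    (heq : ∀ q ∈ strip, lap ψ q + f q.2 * pd2 ψ q + g (q.2, ψ q) + h (ψ q) = 0)
    (hbot : ∀ x : ℝ, ψ (x, 1 / 2) = 0) (htop : ∀ x : ℝ, ψ (x, 1) = c)
    (halt : (∀ q : ℝ × ℝ, q.2 ∈ Set.Ioo (1 / 2 : ℝ) 1 → 0 < ψ q ∧ ψ q < c) ∨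
            (∀ q ∈ strip, 0 ≤ pd2 ψ q)) :
    ∃ ψb : ℝ → ℝ, ∀ q ∈ strip, ψ q = ψb q.2 := by
  obtain ⟨Kf, hKf⟩ := hf
  obtain ⟨Kg, hKg⟩ := hg
  obtain ⟨Kh, hKh⟩ := hh
  have hg' : ∀ y s s', |g (y, s) - g (y, s')| ≤ Kg * |s - s'| := fun y s s' => by
    simpa [Prod.dist_eq, Real.dist_eq] using hKg.dist_le_mul (y, s) (y, s')
  have hh' : ∀ s s', |h s - h s'| ≤ Kh * |s - s'| := fun s s' => by
    simpa [Real.dist_eq] using hKh.dist_le_mul s s'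
  have hK : (0 : ℝ) ≤ Kg + Kh := by positivity
  obtain ⟨F, hF⟩ := (isCompact_Icc (a := (1 / 2 : ℝ)) (b := 1)).exists_bound_of_continuousOn
    hKf.continuous.continuousOn
  have hint : ∀ q : ℝ × ℝ, q.2 ∈ Ioo (1 / 2 : ℝ) 1 → 0 < ψ q ∧ ψ q < c := by
    refine halt.elim id fun hmono q hq => ?_
    have hs := strictMonoOn_of_pd2_nonneg hg' hh' hK hF hfmono hgmono hψ hc heq hbot htop
      hmono q.1
    have h1 := hs (left_mem_Icc.2 (by norm_num)) (Ioo_subset_Icc_self hq) hq.1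
    have h2 := hs (Ioo_subset_Icc_self hq) (right_mem_Icc.2 (by norm_num)) hq.2
    simp only [hbot, htop] at h1 h2
    exact ⟨h1, h2⟩
  have hle := fun {y : ℝ} (hy : y ∈ Icc (1 / 2 : ℝ) 1) (x x' : ℝ) =>
    le_of_mem_Ioo hg' hh' hK hF hfmono hgmono hψ hper hc heq hbot htop hint hy x x'
  exact ⟨fun y => ψ (0, y), fun q hq => le_antisymm (hle hq q.1 0) (hle hq 0 q.1)⟩
end

section
/- Let D₀ = 𝕋 × [1/2, 1] and let f : [1/2,1] → ℝ, g : [1/2,1] × ℝ → ℝ, h : ℝ → ℝ be Lipschitz functions, with f nondecreasing and g(·, s) nondecreasing in y for every fixed s. Let ψ ∈ C²(D₀) be 2π-periodic in the first variable, solve Δψ + f(y) ∂_y ψ + g(y, ψ) + h(ψ) = 0 in D₀ with ψ(x, 1/2) = 0 and ψ(x, 1) = c for a constant c > 0, and satisfy both ∂_y ψ ≥ 0 on D₀ and 0 < ψ < c in the interior of D₀. Then for every ξ = (ξ₁, ξ₂) ∈ ℝ² with ξ₂ > 0 and every τ > 0 with τ ξ₂ < 1/2, the function w^τ(x, y) :=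 ψ(x + τξ₁, y + τξ₂) − ψ(x, y) is strictly positive at every point of the closed strip 𝕋 × [1/2, 1 − τξ₂]. -/
open Real

theorem hasDerivAt_fst_slice {w : ℝ × ℝ → ℝ} (hw : Differentiable ℝ w) (x y : ℝ) :
    HasDerivAt (fun t => w (t, y)) (pd1 w (x, y)) x :=
  (hw (x, y)).hasFDerivAt.comp_hasDerivAt x ((hasDerivAt_id x).prodMk (hasDerivAt_const x y))

theorem hasDerivAt_snd_slice {w : ℝ × ℝ → ℝ} (hw : Differentiable ℝ w) (x y : ℝ) :
    HasDerivAt (fun t => w (x, t)) (pd2 w (x, y)) y :=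
  (hw (x, y)).hasFDerivAt.comp_hasDerivAt y ((hasDerivAt_const y x).prodMk (hasDerivAt_id y))

theorem differentiable_fderiv_apply {w : ℝ × ℝ → ℝ} (hw : ContDiff ℝ 2 w) (v : ℝ × ℝ) :
    Differentiable ℝ (fun q => fderiv ℝ w q v) := by
  have h : ContDiff ℝ 1 (fderiv ℝ w) := hw.fderiv_right (by norm_num)
  exact (h.clm_apply contDiff_const).differentiable (by norm_num)

/-- The second derivative is nonnegative at a local minimum. -/
theorem IsLocalMin.second_deriv_nonneg {F F' : ℝ → ℝ} {x s : ℝ} (hmin : IsLocalMin F x)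
    (hF : ∀ t, HasDerivAt F (F' t) t) (hF' : HasDerivAt F' s x) : 0 ≤ s := by
  by_contra! hs
  have hd : deriv F = F' := funext fun t => (hF t).deriv
  have hmax : IsLocalMax F x := by
    refine isLocalMax_of_deriv_deriv_neg ?_ hmin.deriv_eq_zero (hF x).continuousAt
    rwa [hd, hF'.deriv]
  have hconst : F =ᶠ[nhds x] fun _ => F x := by
    filter_upwards [hmin, hmax] with t h₁ h₂ using le_antisymm h₂ h₁
  have h0 : F' =ᶠ[nhds x] fun _ => 0 := by
    filter_upwards [hconst.deriv] with t ht
    simpa [hd] using ht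
  exact hs.ne (hF'.unique ((hasDerivAt_const x (0 : ℝ)).congr_of_eventuallyEq h0))

theorem exists_eq_of_periodic_fst {w : ℝ × ℝ → ℝ}
    (hper : ∀ q : ℝ × ℝ, w (q.1 + 2 * π, q.2) = w q) (x : ℝ) :
    ∃ t ∈ Set.Icc 0 (2 * π), ∀ y, w (x, y) = w (t, y) := by
  have hP : Function.Periodic (fun x y => w (x, y)) (2 * π) :=
    fun x => funext fun y => hper (x, y)
  obtain ⟨t, ht, he⟩ := hP.exists_mem_Ico₀ (by positivity) x
  exact ⟨t, Set.Ico_subset_Icc_self ht, fun y => congrFun he y⟩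

/-- A continuous function that is periodic in `x` attains its minimum over a closed strip. -/
theorem exists_min_of_periodic_fst {w : ℝ × ℝ → ℝ} (hw : Continuous w)
    (hper : ∀ q : ℝ × ℝ, w (q.1 + 2 * π, q.2) = w q) {α β : ℝ} (hαβ : α ≤ β) :
    ∃ x₀, ∃ y₀ ∈ Set.Icc α β, ∀ x, ∀ y ∈ Set.Icc α β, w (x₀, y₀) ≤ w (x, y) := by
  obtain ⟨⟨x₀, y₀⟩, hq, hmin⟩ := (isCompact_Icc.prod isCompact_Icc).exists_isMinOn
    (s := Set.Icc 0 (2 * π) ×ˢ Set.Icc α β)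
    ⟨(0, α), ⟨by simp [pi_pos.le], by simp [hαβ]⟩⟩ hw.continuousOn
  refine ⟨x₀, y₀, hq.2, fun x y hy => ?_⟩
  obtain ⟨t, ht, he⟩ := exists_eq_of_periodic_fst hper x
  rw [he]
  exact hmin (Set.mk_mem_prod ht hy)

/-- A positivity principle for periodic supersolutions `Δw + F(y) ∂_y w - K w ≤ 0` on a strip
which are positive on its boundary, obtained by comparison with an exponential barrier. -/
theorem pos_of_supersolution {w : ℝ × ℝ → ℝ} (hw : ContDiff ℝ 2 w)
    (hper : ∀ q : ℝ × ℝ, w (q.1 + 2 * π, q.2) = w q) {α β : ℝ} (hαβ : α ≤ β)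
    {F : ℝ → ℝ} {M K : ℝ} (hM : 0 ≤ M) (hK : 0 ≤ K) (hF : ∀ y ∈ Set.Icc α β, F y ≤ M)
    (hα : ∀ x, 0 < w (x, α)) (hβ : ∀ x, 0 < w (x, β))
    (hsup : ∀ x, ∀ y ∈ Set.Icc α β,
      lap w (x, y) + F y * pd2 w (x, y) - K * w (x, y) ≤ 0) :
    ∀ x, ∀ y ∈ Set.Icc α β, 0 < w (x, y) := by
  have hcw : Continuous w := hw.continuous
  have hdw : Differentiable ℝ w := hw.differentiable (by norm_num)
  obtain ⟨x₁, y₁, hy₁, hmin₁⟩ := exists_min_of_periodic_fst hcw hper (le_refl α)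
  obtain ⟨x₂, y₂, hy₂, hmin₂⟩ := exists_min_of_periodic_fst hcw hper (le_refl β)
  obtain rfl : y₁ = α := by simpa using hy₁
  obtain rfl : y₂ = β := by simpa using hy₂
  obtain ⟨δ, hδ, hδ₁, hδ₂⟩ : ∃ δ > 0, (∀ x, δ ≤ w (x, y₁)) ∧ ∀ x, δ ≤ w (x, y₂) :=
    ⟨min (w (x₁, y₁)) (w (x₂, y₂)), lt_min (hα _) (hβ _),
      fun x => (min_le_left _ _).trans (hmin₁ x _ (by simp)),
      fun x => (min_le_right _ _).trans (hmin₂ x _ (by simp))⟩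
  set l : ℝ := M + K + 1 with hl
  set v : ℝ → ℝ := fun y => δ * exp (-l * (y - y₁)) with hv
  have hvpos : ∀ y, 0 < v y := fun y => by positivity
  have hvle : ∀ y, y₁ ≤ y → v y ≤ δ := fun y hy => by
    have : exp (-l * (y - y₁)) ≤ 1 := exp_le_one_iff.2 (by
      have : 0 ≤ l * (y - y₁) := mul_nonneg (by positivity) (by linarith)
      linarith)
    exact mul_le_of_le_one_right hδ.le this
  have hdv : ∀ y, HasDerivAt v (-l * v y) y := fun y => by
    have h := (((((hasDerivAt_id y).sub_const y₁).const_mul (-l)).exp).const_mul δ)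
    refine h.congr_deriv ?_
    simp only [hv, id]
    ring
  have hcv : Continuous v := continuous_iff_continuousAt.2 fun y => (hdv y).continuousAt
  obtain ⟨x₀, y₀, hy₀, hmin⟩ := exists_min_of_periodic_fst
    (w := fun q => w q - v q.2) (by fun_prop) (fun q => by simp only [hper]) hαβ
  simp only at hmin
  suffices h0 : 0 ≤ w (x₀, y₀) - v y₀ by
    intro x y hy
    linarith [hmin x y hy, hvpos y]
  by_contra! hneg
  have hlt₁ : y₁ < y₀ := lt_of_le_of_ne hy₀.1 (by
    rintro rfl
    linarith [hvle _ le_rfl, hδ₁ x₀])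
  have hlt₂ : y₀ < y₂ := lt_of_le_of_ne hy₀.2 (by
    rintro rfl
    linarith [hvle _ hy₀.1, hδ₂ x₀])
  have hxx : 0 ≤ pd1 (pd1 w) (x₀, y₀) := by
    refine IsLocalMin.second_deriv_nonneg (F := fun t => w (t, y₀)) ?_
      (fun t => hasDerivAt_fst_slice hdw t y₀)
      (hasDerivAt_fst_slice (differentiable_fderiv_apply hw _) x₀ y₀)
    exact Filter.Eventually.of_forall fun t => by linarith [hmin t y₀ hy₀]
  have hlocy : IsLocalMin (fun t => w (x₀, t) - v t) y₀ := by
    filter_upwards [Icc_mem_nhds hlt₁ hlt₂] with t ht using hmin x₀ t ht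
  have hdy : ∀ t, HasDerivAt (fun t => w (x₀, t) - v t) (pd2 w (x₀, t) - -l * v t) t :=
    fun t => (hasDerivAt_snd_slice hdw x₀ t).sub (hdv t)
  have hy : pd2 w (x₀, y₀) - -l * v y₀ = 0 := hlocy.hasDerivAt_eq_zero (hdy y₀)
  have hyy : 0 ≤ pd2 (pd2 w) (x₀, y₀) - -l * (-l * v y₀) :=
    hlocy.second_deriv_nonneg hdy
      ((hasDerivAt_snd_slice (differentiable_fderiv_apply hw _) x₀ y₀).sub
        ((hdv y₀).const_mul (-l)))
  have hs := hsup x₀ y₀ hy₀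
  rw [lap, show pd2 w (x₀, y₀) = -l * v y₀ by linarith] at hs
  have hKw : K * w (x₀, y₀) ≤ K * v y₀ := mul_le_mul_of_nonneg_left (by linarith) hK
  have hFl : F y₀ * (l * v y₀) ≤ M * (l * v y₀) :=
    mul_le_mul_of_nonneg_right (hF y₀ hy₀) (mul_nonneg (by positivity) (hvpos y₀).le)
  have hbar : 0 < (l * l - M * l - K) * v y₀ := by
    refine mul_pos ?_ (hvpos y₀)
    rw [hl]
    nlinarith [mul_nonneg hM hK, mul_nonneg hK hK]
  linarith

theorem pd2_shift_sub {ψ : ℝ × ℝ → ℝ} (hψ : Differentiable ℝ ψ) (p q : ℝ × ℝ) :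
    pd2 (fun q => ψ (q + p) - ψ q) q = pd2 ψ (q + p) - pd2 ψ q := by
  have h : DifferentiableAt ℝ (fun q => ψ (q + p)) q := by fun_prop
  simp only [pd2]
  rw [fderiv_fun_sub h (hψ q), fderiv_comp_add_right]
  rfl

theorem pd1_shift_sub {ψ : ℝ × ℝ → ℝ} (hψ : Differentiable ℝ ψ) (p q : ℝ × ℝ) :
    pd1 (fun q => ψ (q + p) - ψ q) q = pd1 ψ (q + p) - pd1 ψ q := by
  have h : DifferentiableAt ℝ (fun q => ψ (q + p)) q := by fun_prop
  simp only [pd1]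
  rw [fderiv_fun_sub h (hψ q), fderiv_comp_add_right]
  rfl

theorem lap_shift_sub {ψ : ℝ × ℝ → ℝ} (hψ : ContDiff ℝ 2 ψ) (p q : ℝ × ℝ) :
    lap (fun q => ψ (q + p) - ψ q) q = lap ψ (q + p) - lap ψ q := by
  have hd : Differentiable ℝ ψ := hψ.differentiable (by norm_num)
  have h₁ : Differentiable ℝ (pd1 ψ) := differentiable_fderiv_apply hψ _
  have h₂ : Differentiable ℝ (pd2 ψ) := differentiable_fderiv_apply hψ _
  rw [lap, funext (pd1_shift_sub hd p), funext (pd2_shift_sub hd p), pd1_shift_sub h₁,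
    pd2_shift_sub h₂, lap, lap]
  ring

theorem LipschitzWith.sub_le_mul_sub {k : ℝ → ℝ} {K : NNReal} (hk : LipschitzWith K k)
    {s t : ℝ} (hst : s ≤ t) : k s - k t ≤ K * (t - s) := by
  have h := hk.dist_le_mul s t
  rw [dist_comm s t, Real.dist_eq, Real.dist_eq, abs_of_nonneg (sub_nonneg.2 hst)] at h
  exact (le_abs_self _).trans h

/-- Sliding/comparison lemma: under the hypotheses of the Liouville theorem
(with both the interior bound `0 < ψ < c` and monotonicity `∂_y ψ ≥ 0`),
for every `ξ` with `ξ₂ > 0` and `τ > 0` with `τ ξ₂ < 1/2` the shifted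
difference `w^τ(x,y) = ψ(x + τξ₁, y + τξ₂) − ψ(x,y)` is strictly positive
on the closed strip `𝕋 × [1/2, 1 − τξ₂]`. -/
theorem shifted_difference_positive
    (f : ℝ → ℝ) (g : ℝ × ℝ → ℝ) (h : ℝ → ℝ)
    (hf : ∃ K, LipschitzWith K f) (hg : ∃ K, LipschitzWith K g)
    (hh : ∃ K, LipschitzWith K h)
    (hfmono : MonotoneOn f (Set.Icc (1 / 2 : ℝ) 1))
    (hgmono : ∀ s : ℝ, MonotoneOn (fun y => g (y, s)) (Set.Icc (1 / 2 : ℝ) 1))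
    (ψ : ℝ × ℝ → ℝ) (hψ : ContDiff ℝ 2 ψ)
    (hper : ∀ q : ℝ × ℝ, ψ (q.1 + 2 * π, q.2) = ψ q)
    (c : ℝ) (hc : 0 < c)
    (heq : ∀ q ∈ strip, lap ψ q + f q.2 * pd2 ψ q + g (q.2, ψ q) + h (ψ q) = 0)
    (hbot : ∀ x : ℝ, ψ (x, 1 / 2) = 0) (htop : ∀ x : ℝ, ψ (x, 1) = c)
    (hmono : ∀ q ∈ strip, 0 ≤ pd2 ψ q)
    (hint : ∀ q : ℝ × ℝ, q.2 ∈ Set.Ioo (1 / 2 : ℝ) 1 → 0 < ψ q ∧ ψ q < c) :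
    ∀ ξ : ℝ × ℝ, 0 < ξ.2 → ∀ τ : ℝ, 0 < τ → τ * ξ.2 < 1 / 2 →
      ∀ q : ℝ × ℝ, q.2 ∈ Set.Icc (1 / 2 : ℝ) (1 - τ * ξ.2) →
        0 < ψ (q.1 + τ * ξ.1, q.2 + τ * ξ.2) - ψ q := by
  obtain ⟨Kf, hf⟩ := hf
  obtain ⟨Kg, hg⟩ := hg
  obtain ⟨Kh, hh⟩ := hh
  have hcψ : Continuous ψ := hψ.continuous
  have hdψ : Differentiable ℝ ψ := hψ.differentiable (by norm_num)
  intro ξ hξ τ hτ hτξ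
  set a := τ * ξ.1
  set b₀ := τ * ξ.2 with hb₀
  have hb₀pos : 0 < b₀ := mul_pos hτ hξ
  clear_value a b₀
  have hwper : ∀ b : ℝ, ∀ q : ℝ × ℝ,
      (fun q : ℝ × ℝ => ψ (q + (a, b)) - ψ q) (q.1 + 2 * π, q.2) =
        (fun q : ℝ × ℝ => ψ (q + (a, b)) - ψ q) q := fun b q => by
    have h := hper (q.1 + a, q.2 + b)
    simp only [Prod.mk_add_mk, hper q] at h ⊢
    rw [show q.1 + 2 * π + a = q.1 + a + 2 * π by ring, h]
    rfl
  have htop' : ∀ b, 0 < b → b ≤ 1 / 2 → ∀ x, 0 < ψ (x + a, 1 - b + b) - ψ (x, 1 - b) := by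
    intro b hb hb' x
    rw [sub_add_cancel, htop]
    rcases hb'.eq_or_lt with rfl | hb'
    · rw [show (1 : ℝ) - 1 / 2 = 1 / 2 by norm_num, hbot]
      linarith
    · linarith [(hint (x, 1 - b) ⟨by simp only; linarith, by simp only; linarith⟩).2]
  have hbot' : ∀ b, 0 < b → b ≤ 1 / 2 → ∀ x, 0 < ψ (x + a, 1 / 2 + b) - ψ (x, 1 / 2) := by
    intro b hb hb' x
    rw [hbot, sub_zero]
    rcases hb'.eq_or_lt with rfl | hb'
    · rw [show (1 : ℝ) / 2 + 1 / 2 = 1 by norm_num, htop]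
      exact hc
    · exact (hint (x + a, 1 / 2 + b) ⟨by simp only; linarith, by simp only; linarith⟩).1
  have hstep : ∀ b, 0 < b → b ≤ 1 / 2 →
      (∀ x, ∀ y ∈ Set.Icc (1 / 2) (1 - b), 0 ≤ ψ (x + a, y + b) - ψ (x, y)) →
      ∀ x, ∀ y ∈ Set.Icc (1 / 2) (1 - b), 0 < ψ (x + a, y + b) - ψ (x, y) := by
    intro b hb hb' hnn
    refine pos_of_supersolution (w := fun q => ψ (q + (a, b)) - ψ q) (F := f)
      (M := |f 1|) (K := Kg + Kh) (by fun_prop) (hwper b) (by linarith) (abs_nonneg _)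
      (by positivity)
      (fun y hy => (hfmono ⟨hy.1, by linarith [hy.2]⟩ (by norm_num) (by linarith [hy.2])).trans
        (le_abs_self _)) (hbot' b hb hb') (htop' b hb hb') fun x y hy => ?_
    rw [lap_shift_sub hψ, pd2_shift_sub hdψ]
    simp only [Prod.mk_add_mk]
    have hyI : y ∈ Set.Icc (1 / 2 : ℝ) 1 := ⟨hy.1, by linarith [hy.2]⟩
    have hybI : y + b ∈ Set.Icc (1 / 2 : ℝ) 1 := ⟨by linarith [hy.1], by linarith [hy.2]⟩
    have hle : y ≤ y + b := by linarith
    have e₁ := heq (x, y) hyI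
    have e₂ := heq (x + a, y + b) hybI
    simp only at e₁ e₂
    have hw := sub_nonneg.1 (hnn x y hy)
    have i₁ := hgmono (ψ (x + a, y + b)) hyI hybI hle
    simp only at i₁
    have i₂ := mul_le_mul_of_nonneg_right (hfmono hyI hybI hle) (hmono (x + a, y + b) hybI)
    have i₃ := hh.sub_le_mul_sub hw
    have i₄ := (hg.comp (LipschitzWith.prodMk_left y)).sub_le_mul_sub hw
    simp only [Function.comp, mul_one] at i₄
    linarith
  let W : ℝ × ℝ × ℝ → ℝ := fun p => ψ (p.2.1 + a, p.2.2 + p.1) - ψ (p.2.1, p.2.2)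
  have hcW : Continuous W := by fun_prop
  let Z : Set (ℝ × ℝ × ℝ) := (Set.Icc b₀ (1 / 2) ×ˢ Set.Icc 0 (2 * π) ×ˢ Set.Icc (1 / 2) 1) ∩
    ({p | p.2.2 ≤ 1 - p.1} ∩ {p | W p ≤ 0})
  have hZ : IsCompact Z :=
    (isCompact_Icc.prod (isCompact_Icc.prod isCompact_Icc)).inter_right
      ((isClosed_le (by fun_prop) (by fun_prop)).inter (isClosed_le hcW continuous_const))
  have hmemZ : ∀ b ∈ Set.Icc b₀ (1 / 2), ∀ x, ∀ y ∈ Set.Icc (1 / 2) (1 - b),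
      ψ (x + a, y + b) - ψ (x, y) ≤ 0 → ∃ p ∈ Z, p.1 = b := by
    intro b hb x y hy hle
    obtain ⟨t, ht, he⟩ := exists_eq_of_periodic_fst
      (w := fun q => ψ (q + (a, b)) - ψ q) (hwper b) x
    have he' : ψ (x + a, y + b) - ψ (x, y) = ψ (t + a, y + b) - ψ (t, y) := he y
    exact ⟨(b, t, y), ⟨⟨hb, ht, hy.1, by linarith [hy.2, hb.1]⟩, hy.2, he'.symm.le.trans hle⟩, rfl⟩
  have hZe : Z = ∅ := by
    by_contra hne
    obtain ⟨⟨b, x₀, y₀⟩, ⟨⟨hb, hx₀, hy₀⟩, hy₀', hW⟩, hbmax⟩ :=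
      hZ.exists_isMaxOn (Set.nonempty_iff_ne_empty.2 hne) continuous_fst.continuousOn
    simp only [Set.mem_ofPred_eq] at hb hx₀ hy₀ hy₀' hW
    have hbpos : 0 < b := hb₀pos.trans_le hb.1
    refine absurd (hstep b hbpos hb.2 (fun x y hy => ?_) x₀ y₀ ⟨hy₀.1, hy₀'⟩) (not_lt.2 hW)
    rcases hy.2.eq_or_lt with rfl | hlt
    · exact (htop' b hbpos hb.2 x).le
    have hcb : Continuous fun b' => W (b', x, y) := by fun_prop
    refine ge_of_tendsto (hcb.continuousAt.tendsto.mono_left nhdsWithin_le_nhds :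
      Filter.Tendsto _ (nhdsWithin b (Set.Ioi b)) _) ?_
    filter_upwards [Ioo_mem_nhdsGT (show b < 1 - y by linarith)] with b' hb'
    by_contra! hneg
    obtain ⟨p, hp, hpb⟩ := hmemZ b' ⟨hb.1.trans hb'.1.le, by linarith [hy.1, hb'.2]⟩ x y
      ⟨hy.1, by linarith [hb'.2]⟩ hneg.le
    have : p.1 ≤ b := hbmax hp
    linarith [hb'.1]
  intro q hq
  by_contra! hle
  obtain ⟨p, hp, -⟩ := hmemZ b₀ ⟨le_rfl, hτξ.le⟩ q.1 q.2 hq hle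
  exact Set.notMem_empty p (hZe ▸ hp)
end

section
/- Let D₀ = 𝕋 × [0,1] be the periodic channel and fix k ≥ 3. Let ψ₀ ∈ C^k(D₀) satisfy: ψ₀ = c₀ on the bottom boundary {y₂ = 0}, ψ₀ = c₁ on the top boundary {y₂ = 1} for constants c₀ ≠ c₁, and |∇ψ₀| ≠ 0 everywhere on D₀. Suppose θ ∈ C^{k−2}(D₀) satisfies ∇⊥ψ₀ · ∇θ = 0 in D₀. Then there exists a (k−2)-times continuously differentiable function Θ : ℝ → ℝ such that θ(y₁, y₂) = Θ(ψ₀(y₁, y₂)) for all (y₁, y₂) ∈ D₀. -/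
open Real

open Set Filter Topology
open scoped NNReal

/-- A bounded, globally Lipschitz vector field has a global integral curve through every point. -/
theorem exists_global_integralCurve {E : Type*} [NormedAddCommGroup E] [NormedSpace ℝ E]
    [CompleteSpace E] {v : E → E} {K L : ℝ≥0} (hv : LipschitzWith K v) (hL : ∀ x, ‖v x‖ ≤ L)
    (x₀ : E) : ∃ γ : ℝ → E, γ 0 = x₀ ∧ ∀ t, HasDerivAt γ (v (γ t)) t := by
  have local_sol (a : ℝ) (ha : 0 < a) : ∃ α : ℝ → E, α 0 = x₀ ∧
      ∀ t ∈ Ioo (-a) a, HasDerivAt α (v (α t)) t := by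
    have hPL : IsPicardLindelof (fun _ => v) (tmin := -a) (tmax := a)
        ⟨0, by constructor <;> linarith⟩ x₀ (L * ⟨a, ha.le⟩) 0 L K :=
      { lipschitzOnWith := fun _ _ => hv.lipschitzOnWith
        continuousOn := fun _ _ => continuousOn_const
        norm_le := fun _ _ x _ => hL x
        mul_max_le := by simp; rfl }
    obtain ⟨α, h0, hα⟩ := hPL.exists_eq_forall_mem_Icc_hasDerivWithinAt₀
    exact ⟨α, h0, fun t ht =>
      (hα t (Ioo_subset_Icc_self ht)).hasDerivAt (Icc_mem_nhds ht.1 ht.2)⟩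
  choose! α h0 hα using local_sol
  have agree {a b : ℝ} (ha : 0 < a) (hab : a ≤ b) : EqOn (α a) (α b) (Ioo (-a) a) :=
    ODE_solution_unique_of_mem_Ioo (v := fun _ => v) (s := fun _ => univ) (t₀ := 0)
      (fun _ _ => hv.lipschitzOnWith) ⟨by linarith, ha⟩
      (fun t ht => ⟨hα a ha t ht, mem_univ _⟩)
      (fun t ht => ⟨hα b (ha.trans_le hab) t ⟨by linarith [ht.1], by linarith [ht.2]⟩, mem_univ _⟩)
      ((h0 a ha).trans (h0 b (ha.trans_le hab)).symm)
  have pos (t : ℝ) : 0 < |t| + 1 := by positivity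
  refine ⟨fun t => α (|t| + 1) t, by simpa using h0 1 one_pos, fun t => ?_⟩
  have heq (s : ℝ) (hs : |s| < |t| + 1) : α (|s| + 1) s = α (|t| + 2) s :=
    agree (pos s) (by linarith) (abs_lt.1 (lt_add_one |s|))
  have hnhds : (fun s => α (|s| + 1) s) =ᶠ[𝓝 t] α (|t| + 2) := by
    filter_upwards [continuous_abs.continuousAt.eventually_lt_const (lt_add_one |t|)] with s hs
    exact heq s hs
  beta_reduce
  rw [heq t (lt_add_one _)]
  exact (hα _ (by positivity) t (abs_lt.1 (by linarith))).congr_of_eventuallyEq hnhds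

theorem contDiff_integralCurve {E : Type*} [NormedAddCommGroup E] [NormedSpace ℝ E]
    {v : E → E} {γ : ℝ → E} (hγ : ∀ t, HasDerivAt γ (v (γ t)) t) (n : ℕ)
    (hv : ContDiff ℝ n v) : ContDiff ℝ n γ := by
  have hdiff : Differentiable ℝ γ := fun t => (hγ t).differentiableAt
  induction n with
  | zero => exact contDiff_zero.2 hdiff.continuous
  | succ n ih =>
    have hγn := ih (hv.of_le (by norm_cast; omega))
    push_cast
    refine contDiff_succ_iff_deriv.2 ⟨hdiff, by simp, ?_⟩
    rw [funext fun t => (hγ t).deriv]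
    exact (hv.of_le (by norm_cast; omega)).comp hγn

/-- A continuous map on the plane which is periodic in the first variable and vanishes outside a
horizontal strip is bounded. -/
theorem exists_norm_le_of_periodic {E : Type*} [NormedAddCommGroup E] {f : ℝ × ℝ → E}
    (hf : Continuous f) {T : ℝ} (hT : 0 < T) (hper : ∀ q : ℝ × ℝ, f (q.1 + T, q.2) = f q)
    {a b : ℝ} (hzero : ∀ q : ℝ × ℝ, q.2 ∉ Icc a b → f q = 0) :
    ∃ M : ℝ≥0, ∀ q, ‖f q‖ ≤ M := by
  obtain ⟨C, hC⟩ := ((isCompact_Icc (a := (0 : ℝ)) (b := T)).prod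
    (isCompact_Icc (a := a) (b := b))).exists_bound_of_continuousOn hf.continuousOn
  refine ⟨C.toNNReal, fun q => ?_⟩
  by_cases hq : q.2 ∈ Icc a b
  · have hp : Function.Periodic (fun x => f (x, q.2)) T := fun x => hper (x, q.2)
    obtain ⟨x, hx, hxq⟩ := hp.exists_mem_Ico₀ hT q.1
    have hxq : f q = f (x, q.2) := hxq
    rw [hxq]
    exact (hC (x, q.2) ⟨Ico_subset_Icc_self hx, hq⟩).trans (le_coe_toNNReal C)
  · simp [hzero q hq]

/-- If `y` leaves `[0, 1]` only when `u` reaches `b`, and `u` has unit speed as long as `y` stays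
in `[0, 1]`, then `y` stays there until `u` reaches `b`. -/
theorem mem_Icc_until {y u : ℝ → ℝ} {b : ℝ} (hy : Continuous y) (hu : Continuous u)
    (hspeed : ∀ s, y s ∈ Icc (0 : ℝ) 1 → HasDerivAt u 1 s)
    (henter : ∀ s, y s = 0 → ∃ d > 0, HasDerivAt y d s) (htop : ∀ s, y s = 1 → u s = b)
    (h0 : y 0 ∈ Icc (0 : ℝ) 1) :
    ∀ s ∈ Icc 0 (b - u 0), y s ∈ Icc (0 : ℝ) 1 ∧ u s = u 0 + s := by
  have hclosed : IsClosed {s | y s ∈ Icc (0 : ℝ) 1 ∧ u s = u 0 + s} :=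
    (isClosed_Icc.preimage hy).inter (isClosed_eq hu (by fun_prop))
  refine (hclosed.inter isClosed_Icc).Icc_subset_of_forall_mem_nhdsWithin ⟨h0, by simp⟩ ?_
  rintro s ⟨⟨hys, hus⟩, -, hsb⟩
  have hlt : y s < 1 := lt_of_le_of_ne hys.2 fun h => by linarith [htop s h]
  have hstay : ∀ᶠ t in 𝓝[>] s, y t ∈ Icc (0 : ℝ) 1 := by
    have h1 : ∀ᶠ t in 𝓝[>] s, y t < 1 :=
      (hy.continuousAt.eventually_lt_const hlt).filter_mono nhdsWithin_le_nhds
    have h2 : ∀ᶠ t in 𝓝[>] s, 0 < y t := by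
      rcases hys.1.eq_or_lt with h | h
      · obtain ⟨d, hd, hder⟩ := henter s h.symm
        have := (hasDerivAt_iff_tendsto_slope.1 hder).eventually_const_lt hd
        filter_upwards [this.filter_mono (nhdsGT_le_nhdsNE s), self_mem_nhdsWithin] with t ht hst
        rw [slope_def_field, ← h, sub_zero] at ht
        exact (div_pos_iff_of_pos_right (sub_pos.2 hst)).1 ht
      · exact (hy.continuousAt.eventually_const_lt h).filter_mono nhdsWithin_le_nhds
    filter_upwards [h1, h2] with t ht1 ht2 using ⟨ht2.le, ht1.le⟩
  obtain ⟨c, hc, hsub⟩ := mem_nhdsGT_iff_exists_Ioc_subset.1 hstay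
  filter_upwards [Ioc_mem_nhdsGT hc] with t ht
  refine ⟨hsub ht, ?_⟩
  have hmem (r : ℝ) (hr : r ∈ Icc s t) : y r ∈ Icc (0 : ℝ) 1 := by
    rcases hr.1.eq_or_lt with h | h
    · exact h ▸ hys
    · exact hsub ⟨h, hr.2.trans ht.2⟩
  have := constant_of_has_deriv_right_zero (f := fun r => u r - r) (a := s) (b := t)
    (by fun_prop) (fun r hr => by
      simpa using ((hspeed r (hmem r ⟨hr.1, hr.2.le⟩)).fun_sub (hasDerivAt_id' r)).hasDerivWithinAt)
    t ⟨ht.1.le, le_rfl⟩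
  linarith

/-- Reversal of `mem_Icc_until`: backwards in time, `y` stays in `[0, 1]` until `u` reaches `a`. -/
theorem mem_Icc_until_backward {y u : ℝ → ℝ} {a : ℝ} (hy : Continuous y) (hu : Continuous u)
    (hspeed : ∀ s, y s ∈ Icc (0 : ℝ) 1 → HasDerivAt u 1 s)
    (hexit : ∀ s, y s = 1 → ∃ d > 0, HasDerivAt y d s) (hbot : ∀ s, y s = 0 → u s = a)
    (h0 : y 0 ∈ Icc (0 : ℝ) 1) :
    ∀ s ∈ Icc (a - u 0) 0, y s ∈ Icc (0 : ℝ) 1 ∧ u s = u 0 + s := by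
  intro s hs
  have key := mem_Icc_until (y := fun s => 1 - y (-s)) (u := fun s => -u (-s)) (b := -a)
    (by fun_prop) (by fun_prop)
    (fun s hs => by
      have h := (hspeed (-s) ⟨by linarith [hs.2], by linarith [hs.1]⟩).scomp s (hasDerivAt_neg s)
      simpa [Function.comp_def] using h.fun_neg)
    (fun s hs => by
      obtain ⟨d, hd, h⟩ := hexit (-s) (by linarith)
      have h := (h.scomp s (hasDerivAt_neg s)).const_sub 1
      exact ⟨d, hd, by simpa using h⟩)
    (fun s hs => by rw [hbot (-s) (by linarith)])
    (by simpa using ⟨h0.2, h0.1⟩) (-s)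
    (by simp only [neg_zero]; constructor <;> linarith [hs.1, hs.2])
  simp only [neg_neg, neg_zero, mem_Icc] at key
  exact ⟨⟨by linarith [key.1.2], by linarith [key.1.1]⟩, by linarith [key.2]⟩

/-- A function without critical points on the channel exceeds in the interior any lower bound of
its boundary values. -/
theorem lt_of_le_boundary {ψ : ℝ × ℝ → ℝ} (hψ : Continuous ψ) {T : ℝ} (hT : 0 < T)
    (hper : ∀ q : ℝ × ℝ, ψ (q.1 + T, q.2) = ψ q) (hcrit : ∀ q ∈ chan, fderiv ℝ ψ q ≠ 0) {m : ℝ}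
    (hbot : ∀ x, m ≤ ψ (x, 0)) (htop : ∀ x, m ≤ ψ (x, 1)) {q : ℝ × ℝ} (hq : q.2 ∈ Ioo (0 : ℝ) 1) :
    m < ψ q := by
  have not_min (q : ℝ × ℝ) (hq : q.2 ∈ Ioo (0 : ℝ) 1) : ¬ IsMinOn ψ chan q := fun hmin =>
    hcrit q (Ioo_subset_Icc_self hq) <| IsLocalMin.fderiv_eq_zero <| hmin.isLocalMin <|
      mem_of_superset ((isOpen_Ioo.preimage continuous_snd).mem_nhds hq)
        fun _ hp => Ioo_subset_Icc_self hp
  obtain ⟨p, ⟨-, hp⟩, hpmin⟩ := ((isCompact_Icc (a := (0 : ℝ)) (b := T)).prod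
    (isCompact_Icc (a := (0 : ℝ)) (b := 1))).exists_isMinOn
    ⟨(0, 0), by simp [hT.le]⟩ hψ.continuousOn
  have hpchan : IsMinOn ψ chan p := fun r hr => by
    have hr' : Function.Periodic (fun x => ψ (x, r.2)) T := fun x => hper (x, r.2)
    obtain ⟨x, hx, hxr⟩ := hr'.exists_mem_Ico₀ hT r.1
    have hxr : ψ r = ψ (x, r.2) := hxr
    simp only [mem_ofPred_eq, hxr]
    exact hpmin (show (x, r.2) ∈ _ from ⟨Ico_subset_Icc_self hx, hr⟩)
  by_contra! hle
  have hmp : m ≤ ψ p := by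
    obtain ⟨x, y⟩ := p
    rcases hp.1.eq_or_lt with h | h
    · obtain rfl : 0 = y := h
      exact hbot x
    rcases hp.2.eq_or_lt with h' | h'
    · obtain rfl : y = 1 := h'
      exact htop x
    · exact absurd hpchan (not_min _ ⟨h, h'⟩)
  exact not_min q hq fun r hr => (hle.trans hmp).trans (hpchan hr)

theorem fderiv_apply_eq (f : ℝ × ℝ → ℝ) (q v : ℝ × ℝ) :
    fderiv ℝ f q v = v.1 * pd1 f q + v.2 * pd2 f q := by
  have : v = v.1 • ((1, 0) : ℝ × ℝ) + v.2 • ((0, 1) : ℝ × ℝ) := by ext <;> simp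
  conv_lhs => rw [this, map_add, map_smul, map_smul]
  rfl

theorem sq_pd_add_pos {ψ : ℝ × ℝ → ℝ} {q : ℝ × ℝ} (h : (pd1 ψ q, pd2 ψ q) ≠ (0, 0)) :
    0 < pd1 ψ q ^ 2 + pd2 ψ q ^ 2 := by
  by_contra! hle
  refine h (Prod.ext ?_ ?_) <;> simp only <;> nlinarith [sq_nonneg (pd1 ψ q), sq_nonneg (pd2 ψ q)]

theorem exists_fderiv_eq_smul {ψ θ : ℝ × ℝ → ℝ} {q : ℝ × ℝ} (h : (pd1 ψ q, pd2 ψ q) ≠ (0, 0))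
    (htrans : -(pd2 ψ q) * pd1 θ q + pd1 ψ q * pd2 θ q = 0) :
    ∃ r : ℝ, fderiv ℝ θ q = r • fderiv ℝ ψ q := by
  have hpos := (sq_pd_add_pos h).ne'
  refine ⟨(pd1 ψ q * pd1 θ q + pd2 ψ q * pd2 θ q) / (pd1 ψ q ^ 2 + pd2 ψ q ^ 2), ?_⟩
  ext <;> simp [fderiv_apply_eq] <;> field_simp
  · linear_combination (-pd2 ψ q) * htrans
  · linear_combination (pd1 ψ q) * htrans

/-- A function whose differential is proportional to that of `ψ` is stationary along Lipschitz
curves in the level sets of `ψ`. -/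
theorem hasDerivAt_zero_of_level {ψ θ : ℝ × ℝ → ℝ} {Φ : ℝ → ℝ × ℝ} {K : ℝ≥0}
    (hΦ : LipschitzWith K Φ) {c : ℝ} (hlevel : ∀ x, ψ (Φ x) = c) {x r : ℝ}
    (hψ : DifferentiableAt ℝ ψ (Φ x)) (hθ : DifferentiableAt ℝ θ (Φ x))
    (hr : fderiv ℝ θ (Φ x) = r • fderiv ℝ ψ (Φ x)) :
    HasDerivAt (fun x => θ (Φ x)) 0 x := by
  have hF : HasFDerivAt (fun q => θ q - r • ψ q) (0 : ℝ × ℝ →L[ℝ] ℝ) (Φ x) := by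
    have := hθ.hasFDerivAt.fun_sub (hψ.hasFDerivAt.fun_const_smul r)
    rwa [hr, sub_self] at this
  have hO : (fun t => Φ t - Φ x) =O[𝓝 x] fun t => t - x :=
    Asymptotics.IsBigO.of_bound K (Eventually.of_forall fun t => hΦ.norm_sub_le t x)
  have ho := (hF.isLittleO.comp_tendsto hΦ.continuous.continuousAt).trans_isBigO hO
  refine hasDerivAt_iff_isLittleO.2 (ho.congr_left fun t => ?_)
  simp [hlevel]

theorem fderiv_add_period {E F : Type*} [NormedAddCommGroup E] [NormedSpace ℝ E]
    [NormedAddCommGroup F] [NormedSpace ℝ F] {f : E × ℝ → F} {T : E}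
    (hper : ∀ q : E × ℝ, f (q.1 + T, q.2) = f q) (q : E × ℝ) :
    fderiv ℝ f (q.1 + T, q.2) = fderiv ℝ f q := by
  have h : (fun p : E × ℝ => f (p + (T, 0))) = f := funext fun p => by
    rw [← hper p]; congr 1; ext <;> simp
  rw [← congrArg (fun g => fderiv ℝ g q) h, fderiv_comp_add_right]
  congr 1; ext <;> simp

/-- A normalized gradient field of `ψ` on the channel, extended to a periodic field on the plane
that vanishes away from the channel. -/
theorem exists_normalized_gradient {ψ : ℝ × ℝ → ℝ} {n : ℕ} (hψ : ContDiff ℝ (n + 1 : ℕ) ψ) {T : ℝ}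
    (hper : ∀ q : ℝ × ℝ, ψ (q.1 + T, q.2) = ψ q)
    (hgrad : ∀ q ∈ chan, (pd1 ψ q, pd2 ψ q) ≠ (0, 0)) :
    ∃ v : ℝ × ℝ → ℝ × ℝ, ContDiff ℝ n v ∧ (∀ q : ℝ × ℝ, v (q.1 + T, q.2) = v q) ∧
      (∀ q : ℝ × ℝ, q.2 ∉ Ioo (-2 : ℝ) 3 → v q = 0) ∧
      ∀ q ∈ chan, fderiv ℝ ψ q (v q) = 1 ∧ ∃ r > 0, (v q).2 = r * pd2 ψ q := by
  let χ : ContDiffBump (1 / 2 : ℝ) := ⟨1, 5 / 2, by norm_num, by norm_num⟩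
  let D : ℝ × ℝ → ℝ := fun q =>
    pd1 ψ q ^ 2 + pd2 ψ q ^ 2 + (expNegInvGlue (-q.2) + expNegInvGlue (q.2 - 1))
  have hfd : ContDiff ℝ n (fderiv ℝ ψ) := hψ.fderiv_right (by norm_cast)
  have hpd1 : ContDiff ℝ n (pd1 ψ) := hfd.clm_apply contDiff_const
  have hpd2 : ContDiff ℝ n (pd2 ψ) := hfd.clm_apply contDiff_const
  have hD : ContDiff ℝ n D := by
    have := expNegInvGlue.contDiff (n := (n : ℕ∞))
    exact ((hpd1.pow 2).add (hpd2.pow 2)).add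
      ((this.comp contDiff_snd.neg).add (this.comp (contDiff_snd.sub contDiff_const)))
  have hDpos (q : ℝ × ℝ) : 0 < D q := by
    have h1 := expNegInvGlue.nonneg (-q.2)
    have h2 := expNegInvGlue.nonneg (q.2 - 1)
    by_cases hq : q ∈ chan
    · exact add_pos_of_pos_of_nonneg (sq_pd_add_pos (hgrad q hq)) (add_nonneg h1 h2)
    · refine add_pos_of_nonneg_of_pos (by positivity) ?_
      rcases lt_or_ge q.2 0 with h | h
      · exact add_pos_of_pos_of_nonneg (expNegInvGlue.pos_of_pos (by linarith)) h2
      · refine add_pos_of_nonneg_of_pos h1 (expNegInvGlue.pos_of_pos ?_)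
        by_contra! h'
        exact hq ⟨h, by linarith⟩
  refine ⟨fun q => (χ q.2 / D q) • (pd1 ψ q, pd2 ψ q), ?_, fun q => ?_, fun q hq => ?_,
    fun q hq => ?_⟩
  · exact ((χ.contDiff.comp contDiff_snd).div hD fun q => (hDpos q).ne').smul (hpd1.prodMk hpd2)
  · simp only [D, pd1, pd2, fderiv_add_period hper]
  · have : χ q.2 = 0 := χ.zero_of_le_dist (by
      rw [Real.dist_eq]
      by_contra! h
      have h : |q.2 - 1 / 2| < 5 / 2 := h
      exact hq ⟨by linarith [(abs_lt.1 h).1], by linarith [(abs_lt.1 h).2]⟩)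
    simp [this]
  · have hχ : χ q.2 = 1 := χ.one_of_mem_closedBall (by
      rw [Metric.mem_closedBall, Real.dist_eq]
      show |q.2 - 1 / 2| ≤ 1
      rw [abs_le]
      constructor <;> linarith [hq.1, hq.2])
    have hDq : D q = pd1 ψ q ^ 2 + pd2 ψ q ^ 2 := by
      have h1 := expNegInvGlue.zero_of_nonpos (x := -q.2) (by linarith [hq.1])
      have h2 := expNegInvGlue.zero_of_nonpos (x := q.2 - 1) (by linarith [hq.2])
      simp only [D, h1, h2, add_zero]
    refine ⟨?_, (D q)⁻¹, inv_pos.2 (hDpos q), by simp [hχ]⟩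
    have := (sq_pd_add_pos (hgrad q hq)).ne'
    simp only [fderiv_apply_eq, hχ, hDq, Prod.smul_mk, smul_eq_mul]
    field_simp

theorem exists_lipschitzWith_of_periodic {E : Type*} [NormedAddCommGroup E] [NormedSpace ℝ E]
    {f : ℝ × ℝ → E} (hf : ContDiff ℝ 1 f) {T : ℝ} (hT : 0 < T)
    (hper : ∀ q : ℝ × ℝ, f (q.1 + T, q.2) = f q) {a b : ℝ}
    (hzero : ∀ q : ℝ × ℝ, q.2 ∉ Icc a b → f q = 0) : ∃ K : ℝ≥0, LipschitzWith K f := by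
  obtain ⟨K, hK⟩ := exists_norm_le_of_periodic (hf.continuous_fderiv one_ne_zero) hT
    (fderiv_add_period hper) (a := a) (b := b) fun q hq => by
      have : f =ᶠ[𝓝 q] fun _ => 0 := by
        filter_upwards [(isClosed_Icc.isOpen_compl.preimage continuous_snd).mem_nhds hq] with p hp
        exact hzero p hp
      rw [this.fderiv_eq, fderiv_fun_const]
      rfl
  exact ⟨K, lipschitzWith_of_nnnorm_fderiv_le (hf.differentiable one_ne_zero) hK⟩

theorem lipschitzWith_flow {E : Type*} [NormedAddCommGroup E] [NormedSpace ℝ E]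
    {v : E → E} {K : ℝ≥0} (hv : LipschitzWith K v) {Φ : E → ℝ → E} (h0 : ∀ x, Φ x 0 = x)
    (hΦ : ∀ x t, HasDerivAt (Φ x) (v (Φ x t)) t) {t : ℝ} (ht : 0 ≤ t) :
    LipschitzWith (exp (K * t)).toNNReal fun x => Φ x t := by
  refine LipschitzWith.of_dist_le_mul fun x x' => ?_
  have hc (x : E) : Continuous (Φ x) :=
    continuous_iff_continuousAt.2 fun t => (hΦ x t).continuousAt
  have := dist_le_of_trajectories_ODE (v := fun _ => v) (fun _ => hv) (hc x).continuousOn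
    (fun s _ => (hΦ x s).hasDerivWithinAt) (hc x').continuousOn
    (fun s _ => (hΦ x' s).hasDerivWithinAt) (a := 0) (b := t) (δ := dist x x') (by simp [h0])
    t ⟨ht, le_rfl⟩
  rw [Real.coe_toNNReal _ (exp_pos _).le, mul_comm]
  simpa using this

/-- The equation of state when `ψ₀` is larger on the top boundary. -/
theorem equation_of_state_of_lt {n m : ℕ} (hn : 1 ≤ n) (hmn : m ≤ n) (hm : 1 ≤ m)
    {ψ θ : ℝ × ℝ → ℝ} (hψreg : ContDiff ℝ (n + 1 : ℕ) ψ) {T : ℝ} (hT : 0 < T)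
    (hper : ∀ q : ℝ × ℝ, ψ (q.1 + T, q.2) = ψ q) {c₀ c₁ : ℝ} (hlt : c₀ < c₁)
    (hbot : ∀ x : ℝ, ψ (x, 0) = c₀) (htop : ∀ x : ℝ, ψ (x, 1) = c₁)
    (hgrad : ∀ q ∈ chan, (pd1 ψ q, pd2 ψ q) ≠ (0, 0)) (hθreg : ContDiff ℝ m θ)
    (htrans : ∀ q ∈ chan, -(pd2 ψ q) * pd1 θ q + pd1 ψ q * pd2 θ q = 0) :
    ∃ Θ : ℝ → ℝ, ContDiff ℝ m Θ ∧ ∀ q ∈ chan, θ q = Θ (ψ q) := by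
  have hψd : Differentiable ℝ ψ := hψreg.differentiable (by norm_cast)
  have hψc := hψd.continuous
  have hθd : Differentiable ℝ θ := hθreg.differentiable (by norm_cast; omega)
  have hcrit (q : ℝ × ℝ) (hq : q ∈ chan) : fderiv ℝ ψ q ≠ 0 := fun h => hgrad q hq (by
    simp [pd1, pd2, h])
  have hlow (q : ℝ × ℝ) (hq : q.2 ∈ Ioo (0 : ℝ) 1) : c₀ < ψ q :=
    lt_of_le_boundary hψc hT hper hcrit (fun x => (hbot x).ge) (fun x => by rw [htop]; exact hlt.le)
      hq
  have hupp (q : ℝ × ℝ) (hq : q.2 ∈ Ioo (0 : ℝ) 1) : ψ q < c₁ := by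
    have := lt_of_le_boundary (ψ := fun q => -ψ q) (m := -c₁) hψc.neg hT (by simpa using hper)
      (fun q hq => by simpa [fderiv_fun_neg] using hcrit q hq)
      (fun x => by rw [hbot]; linarith) (fun x => by rw [htop]) hq
    linarith
  have hmem (q : ℝ × ℝ) (hq : q ∈ chan) : ψ q ∈ Icc c₀ c₁ := by
    obtain ⟨x, y⟩ := q
    rcases hq.1.eq_or_lt with h | h
    · obtain rfl : 0 = y := h
      simp [hbot, hlt.le]
    rcases hq.2.eq_or_lt with h' | h'
    · obtain rfl : y = 1 := h'
      simp [htop, hlt.le]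
    · exact ⟨(hlow _ ⟨h, h'⟩).le, (hupp _ ⟨h, h'⟩).le⟩
  have hpd2 (q : ℝ × ℝ) (hq : q.2 = 0 ∨ q.2 = 1) : 0 < pd2 ψ q := by
    obtain ⟨x, y⟩ := q
    have hvert : HasDerivAt (fun s => ψ (x, s)) (pd2 ψ (x, y)) y :=
      (hψd (x, y)).hasFDerivAt.comp_hasDerivAt y ((hasDerivAt_const y x).prodMk (hasDerivAt_id y))
    have hpd1 : pd1 ψ (x, y) = 0 := by
      have hhor : HasDerivAt (fun s => ψ (s, y)) (pd1 ψ (x, y)) x :=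
        (hψd (x, y)).hasFDerivAt.comp_hasDerivAt x
          ((hasDerivAt_id x).prodMk (hasDerivAt_const x y))
      refine hhor.unique ?_
      rcases hq with h | h <;> obtain rfl : y = _ := h
      · simpa only [hbot] using hasDerivAt_const x c₀
      · simpa only [htop] using hasDerivAt_const x c₁
    have hne : pd2 ψ (x, y) ≠ 0 := fun h => hgrad (x, y)
      (by rcases hq with h | h <;> simp only at h <;> simp [chan, h]) (by rw [hpd1, h])
    refine lt_of_le_of_ne ?_ hne.symm
    rcases hq with h | h <;> obtain rfl : y = _ := h
    · refine ge_of_tendsto (hasDerivAt_iff_tendsto_slope_left_right.1 hvert).2 ?_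
      filter_upwards [Ioc_mem_nhdsGT one_pos] with s hs
      rw [slope_def_field, hbot]
      exact div_nonneg (sub_nonneg.2 (hmem (x, s) ⟨hs.1.le, hs.2⟩).1) (by linarith [hs.1])
    · refine ge_of_tendsto (hasDerivAt_iff_tendsto_slope_left_right.1 hvert).1 ?_
      filter_upwards [Ico_mem_nhdsLT one_pos] with s hs
      rw [slope_def_field, htop]
      exact div_nonneg_of_nonpos (sub_nonpos.2 (hmem (x, s) ⟨hs.1, hs.2.le⟩).2)
        (by linarith [hs.2])
  obtain ⟨v, hv, hvper, hvzero, hvchan⟩ := exists_normalized_gradient hψreg hper hgrad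
  have hvzero' (q : ℝ × ℝ) (hq : q.2 ∉ Icc (-2 : ℝ) 3) : v q = 0 :=
    hvzero q fun h => hq (Ioo_subset_Icc_self h)
  obtain ⟨L, hL⟩ := exists_norm_le_of_periodic hv.continuous hT hvper hvzero'
  obtain ⟨K, hK⟩ := exists_lipschitzWith_of_periodic (hv.of_le (by exact_mod_cast hn)) hT hvper
    hvzero'
  choose Φ hΦ0 hΦ using exists_global_integralCurve hK hL
  have hΦc (q : ℝ × ℝ) : Continuous (Φ q) :=
    continuous_iff_continuousAt.2 fun t => (hΦ q t).continuousAt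
  have hspeed (q : ℝ × ℝ) (s : ℝ) (hs : Φ q s ∈ chan) : HasDerivAt (fun t => ψ (Φ q t)) 1 s := by
    rw [← (hvchan _ hs).1]
    exact (hψd _).hasFDerivAt.comp_hasDerivAt s (hΦ q s)
  have hcross (q : ℝ × ℝ) (s : ℝ) (hs : (Φ q s).2 = 0 ∨ (Φ q s).2 = 1) :
      ∃ d > 0, HasDerivAt (fun t => (Φ q t).2) d s := by
    obtain ⟨r, hr, hvr⟩ := (hvchan (Φ q s) (by rcases hs with h | h <;> simp [chan, h])).2
    exact ⟨_, hvr ▸ mul_pos hr (hpd2 _ hs), (hΦ q s).snd⟩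
  have hfwd (x : ℝ) : ∀ s ∈ Icc 0 (c₁ - c₀), Φ (x, 0) s ∈ chan ∧ ψ (Φ (x, 0) s) = c₀ + s := by
    have := mem_Icc_until (y := fun s => (Φ (x, 0) s).2) (u := fun s => ψ (Φ (x, 0) s)) (b := c₁)
      (hΦc _).snd (hψc.comp (hΦc _)) (hspeed _) (fun s hs => hcross _ s (.inl hs))
      (fun s hs => by rw [← htop (Φ (x, 0) s).1, ← hs]) (by simp [hΦ0])
    simp only [hΦ0, hbot] at this
    exact this
  refine ⟨fun c => θ (Φ (0, 0) (c - c₀)), ?_, fun q hq => ?_⟩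
  · exact hθreg.comp (((contDiff_integralCurve (hΦ (0, 0)) n hv).of_le (by exact_mod_cast hmn)).comp
      (contDiff_id.sub contDiff_const))
  have hc := hmem q hq
  obtain ⟨x, hx⟩ : ∃ x, Φ (x, 0) (ψ q - c₀) = q := by
    have hbwd := mem_Icc_until_backward (y := fun s => (Φ q s).2) (u := fun s => ψ (Φ q s))
      (a := c₀) (hΦc _).snd (hψc.comp (hΦc _)) (hspeed _) (fun s hs => hcross _ s (.inr hs))
      (fun s hs => by rw [← hbot (Φ q s).1, ← hs]) (by rw [hΦ0]; exact hq) (c₀ - ψ q)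
      (by simpa [hΦ0] using hc.1)
    simp only [hΦ0, add_sub_cancel] at hbwd
    obtain ⟨hp, hψp⟩ := hbwd
    have hp0 : (Φ q (c₀ - ψ q)).2 = 0 := by
      rcases hp.1.eq_or_lt with h | h
      · exact h.symm
      rcases hp.2.eq_or_lt with h' | h'
      · have := htop (Φ q (c₀ - ψ q)).1
        rw [← h', hψp] at this
        exact absurd this hlt.ne
      · exact absurd hψp (hlow _ ⟨h, h'⟩).ne'
    refine ⟨(Φ q (c₀ - ψ q)).1, ?_⟩
    have := ODE_solution_unique_univ (v := fun _ => v) (s := fun _ => univ) (t₀ := 0)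
      (f := Φ ((Φ q (c₀ - ψ q)).1, 0)) (g := fun s => Φ q (s + (c₀ - ψ q)))
      (fun _ => hK.lipschitzOnWith) (fun t => ⟨hΦ _ t, mem_univ _⟩)
      (fun t => ⟨(hΦ q _).comp_add_const t _, mem_univ _⟩) (by
        rw [hΦ0, zero_add, ← hp0])
    rw [this]
    simp [hΦ0]
  have hs : ψ q - c₀ ∈ Icc 0 (c₁ - c₀) := ⟨by linarith [hc.1], by linarith [hc.2]⟩
  have hlip : LipschitzWith _ fun x : ℝ => Φ (x, 0) (ψ q - c₀) :=
    (lipschitzWith_flow hK hΦ0 hΦ hs.1).comp (LipschitzWith.prodMk_right (0 : ℝ))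
  have hder (x : ℝ) : HasDerivAt (fun x => θ (Φ (x, 0) (ψ q - c₀))) 0 x := by
    obtain ⟨hp, -⟩ := hfwd x _ hs
    obtain ⟨r, hr⟩ := exists_fderiv_eq_smul (hgrad _ hp) (htrans _ hp)
    exact hasDerivAt_zero_of_level hlip (fun x => (hfwd x _ hs).2) (hψd _) (hθd _) hr
  have := is_const_of_deriv_eq_zero (fun x => (hder x).differentiableAt)
    (fun x => (hder x).deriv) x 0
  simpa only [hx] using this

/-- Equation of state lemma: if `ψ₀ ∈ Cᵏ` (k ≥ 3) has no stagnation points in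
the periodic channel, is constant (with distinct values) on the two boundary
lines, and `θ ∈ C^{k-2}` is transported, i.e. `∇⊥ψ₀ · ∇θ = 0`, then
`θ = Θ(ψ₀)` for some `C^{k-2}` function `Θ : ℝ → ℝ`. -/
theorem equation_of_state
    (k : ℕ) (hk : 3 ≤ k) (ψ₀ θ : ℝ × ℝ → ℝ)
    (hψreg : ContDiff ℝ (k : ℕ∞) ψ₀)
    (hψper : ∀ q : ℝ × ℝ, ψ₀ (q.1 + 2 * π, q.2) = ψ₀ q)
    (c₀ c₁ : ℝ) (hne : c₀ ≠ c₁)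
    (hbot : ∀ x : ℝ, ψ₀ (x, 0) = c₀) (htop : ∀ x : ℝ, ψ₀ (x, 1) = c₁)
    (hgrad : ∀ q ∈ chan, (pd1 ψ₀ q, pd2 ψ₀ q) ≠ (0, 0))
    (hθreg : ContDiff ℝ ((k - 2 : ℕ) : ℕ∞) θ)
    (hθper : ∀ q : ℝ × ℝ, θ (q.1 + 2 * π, q.2) = θ q)
    (htrans : ∀ q ∈ chan, (-(pd2 ψ₀ q)) * pd1 θ q + pd1 ψ₀ q * pd2 θ q = 0) :
    ∃ Θ : ℝ → ℝ, ContDiff ℝ ((k - 2 : ℕ) : ℕ∞) Θ ∧ ∀ q ∈ chan, θ q = Θ (ψ₀ q) := by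

  obtain ⟨n, rfl⟩ : ∃ n, k = n + 1 := ⟨k - 1, by omega⟩
  have hT : 0 < 2 * π := by positivity
  rcases hne.lt_or_gt with hlt | hlt
  · exact equation_of_state_of_lt (by omega) (by omega) (by omega) hψreg hT hψper hlt hbot htop
      hgrad hθreg htrans
  · have h1 (q : ℝ × ℝ) : pd1 (fun q => -ψ₀ q) q = -pd1 ψ₀ q := by simp [pd1, fderiv_fun_neg]
    have h2 (q : ℝ × ℝ) : pd2 (fun q => -ψ₀ q) q = -pd2 ψ₀ q := by simp [pd2, fderiv_fun_neg]
    obtain ⟨Θ, hΘ, h⟩ := equation_of_state_of_lt (n := n) (m := n + 1 - 2) (θ := θ)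
      (ψ := fun q => -ψ₀ q) (by omega) (by omega) (by omega) hψreg.neg hT
      (fun q => congrArg Neg.neg (hψper q)) (neg_lt_neg hlt) (by simp [hbot]) (by simp [htop])
      (by simpa [h1, h2] using hgrad) hθreg
      (fun q hq => by rw [h1, h2]; linarith [htrans q hq])
    exact ⟨fun c => Θ (-c), hΘ.comp contDiff_neg, h⟩
end

section
/- Let D₀ = 𝕋 × [0,1] be the periodic channel. Let F ∈ C¹(ℝ) and ψ ∈ C³(D₀) satisfy Δψ = F(ψ) in D₀, with ψ constant on each of the two boundary lines {y₂ = 0} and {y₂ = 1}. Assume the linearized operator has trivial kernel in the following sense: every u ∈ C²(D₀) (2π-periodic in y₁) that vanishes on {y₂ = 0} ∪ {y₂ = 1} and satisfies Δu = F'(ψ) u in D₀ is identically zero. Then ∂_{y₁} ψ ≡ 0 on D₀, i.e. ψ depends only on y₂ and the velocity u = ∇⊥ψ is a shear flow. -/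
open Real

theorem pd_contDiff {f : ℝ × ℝ → ℝ} {m n : ℕ∞} (hf : ContDiff ℝ n f) (hmn : m + 1 ≤ n) :
    ContDiff ℝ m (pd1 f) ∧ ContDiff ℝ m (pd2 f) := by
  have h : ContDiff ℝ m (fderiv ℝ f) := hf.fderiv_right (by exact_mod_cast hmn)
  exact ⟨h.clm_apply contDiff_const, h.clm_apply contDiff_const⟩

theorem pd2_pd1_comm {f : ℝ × ℝ → ℝ} (hf : ContDiff ℝ 2 f) : pd2 (pd1 f) = pd1 (pd2 f) := by
  have hd : Differentiable ℝ (fderiv ℝ f) :=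
    (hf.fderiv_right (m := 1) (by norm_num)).differentiable (by norm_num)
  have key (q v w : ℝ × ℝ) :
      fderiv ℝ (fun p => fderiv ℝ f p v) q w = fderiv ℝ (fderiv ℝ f) q w v := by
    rw [fderiv_clm_apply (hd q) (differentiableAt_const v)]
    simp
  funext q
  have hs : IsSymmSndFDerivAt ℝ f q := hf.contDiffAt.isSymmSndFDerivAt (by simp)
  exact (key q (1, 0) (0, 1)).trans ((hs _ _).trans (key q (0, 1) (1, 0)).symm)

theorem hasDerivAt_pd1_s7 {f : ℝ × ℝ → ℝ} (hf : Differentiable ℝ f) (q : ℝ × ℝ) :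
    HasDerivAt (fun t => f (t, q.2)) (pd1 f q) q.1 :=
  (hf q).hasFDerivAt.comp_hasDerivAt q.1 ((hasDerivAt_id q.1).prodMk (hasDerivAt_const q.1 q.2))

theorem lap_pd1 {f : ℝ × ℝ → ℝ} (hf : ContDiff ℝ 3 f) : lap (pd1 f) = pd1 (lap f) := by
  obtain ⟨h1, h2⟩ := pd_contDiff (m := 2) (n := 3) hf (by norm_num)
  have h11 := (pd_contDiff (m := 1) (n := 2) h1 (by norm_num)).1
  have h22 := (pd_contDiff (m := 1) (n := 2) h2 (by norm_num)).2
  funext q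
  have hadd : lap f = pd1 (pd1 f) + pd2 (pd2 f) := rfl
  have hsum : pd1 (lap f) q = pd1 (pd1 (pd1 f)) q + pd1 (pd2 (pd2 f)) q := by
    rw [hadd]
    unfold pd1 at h11 ⊢
    rw [fderiv_add (h11.differentiable (by norm_num) q) (h22.differentiable (by norm_num) q)]
    rfl
  rw [hsum, ← pd2_pd1_comm h2, ← pd2_pd1_comm (hf.of_le (by norm_num))]
  rfl

/-- Rigidity in the channel from triviality of the kernel of the linearized
operator: if `Δψ = F(ψ)` with `ψ` constant on each boundary line and the only
periodic `C²` solution of `Δu = F'(ψ)u` vanishing on the boundary is `u ≡ 0`,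
then `∂_{y₁} ψ ≡ 0`, i.e. `ψ` depends only on `y₂`. -/
theorem rigidity_trivial_kernel_channel
    (F : ℝ → ℝ) (hF : ContDiff ℝ 1 F)
    (ψ : ℝ × ℝ → ℝ) (hψ : ContDiff ℝ 3 ψ)
    (hψper : ∀ q : ℝ × ℝ, ψ (q.1 + 2 * π, q.2) = ψ q)
    (heq : ∀ q ∈ chan, lap ψ q = F (ψ q))
    (c₀ c₁ : ℝ)
    (hbot : ∀ x : ℝ, ψ (x, 0) = c₀) (htop : ∀ x : ℝ, ψ (x, 1) = c₁)
    (hker : ∀ u : ℝ × ℝ → ℝ, ContDiff ℝ 2 u →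
      (∀ q : ℝ × ℝ, u (q.1 + 2 * π, q.2) = u q) →
      (∀ q : ℝ × ℝ, (q.2 = 0 ∨ q.2 = 1) → u q = 0) →
      (∀ q ∈ chan, lap u q = deriv F (ψ q) * u q) →
      ∀ q ∈ chan, u q = 0) :
    ∀ q ∈ chan, pd1 ψ q = 0 := by
  have hd : Differentiable ℝ ψ := hψ.differentiable (by norm_num)
  refine hker (pd1 ψ) (pd_contDiff (m := 2) (n := 3) hψ (by norm_num)).1 ?_ ?_ ?_
  · intro q
    have h := (hasDerivAt_pd1_s7 hd (q.1 + 2 * π, q.2)).comp_add_const q.1 (2 * π)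
    exact h.unique ((hasDerivAt_pd1_s7 hd q).congr_of_eventuallyEq
      (.of_forall fun t => hψper (t, q.2)))
  · rintro ⟨x, y⟩ (rfl | rfl)
    · exact (hasDerivAt_pd1_s7 hd (x, 0)).unique
        ((hasDerivAt_const x c₀).congr_of_eventuallyEq (.of_forall hbot))
    · exact (hasDerivAt_pd1_s7 hd (x, 1)).unique
        ((hasDerivAt_const x c₁).congr_of_eventuallyEq (.of_forall htop))
  · intro q hq
    obtain ⟨h1, h2⟩ := pd_contDiff (m := 2) (n := 3) hψ (by norm_num)
    have hl : ContDiff ℝ 1 (lap ψ) :=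
      (pd_contDiff (m := 1) (n := 2) h1 (by norm_num)).1.add
        (pd_contDiff (m := 1) (n := 2) h2 (by norm_num)).2
    have hF' : HasDerivAt F (deriv F (ψ q)) (ψ q) :=
      (hF.differentiable (by norm_num) _).hasDerivAt
    rw [lap_pd1 hψ]
    exact (hasDerivAt_pd1_s7 (hl.differentiable (by norm_num)) q).unique
      ((hF'.comp q.1 (hasDerivAt_pd1_s7 hd q)).congr_of_eventuallyEq
        (.of_forall fun t => heq (t, q.2) hq))
end

section
/- Let A = {x ∈ ℝ² : 1 ≤ |x| ≤ 2} be the closed annulus. Let F ∈ C¹(ℝ) and ψ ∈ C³(A) satisfy Δψ = F(ψ) in A, with ψ constant on each of the two boundary circles {|x| = 1} and {|x| = 2}. Assume that every u ∈ C²(A) vanishing on both boundary circles and satisfying Δu = F'(ψ) u in A is identically zero. Then ψ is radial: the angular derivative x₁ ∂₂ψ − x₂ ∂₁ψ vanishes identically, so ψ(x) = Ψ(|x|) for some function Ψ. -/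
open Real

/-- The Euclidean norm on `ℝ × ℝ`. -/
noncomputable def nrm (x : ℝ × ℝ) : ℝ := Real.sqrt (x.1 ^ 2 + x.2 ^ 2)

/-- The closed annulus `{1 ≤ |x| ≤ 2}` in the plane. -/
noncomputable def ann : Set (ℝ × ℝ) := {x | 1 ≤ nrm x ∧ nrm x ≤ 2}

lemma ContDiff.pd1 {f : ℝ × ℝ → ℝ} {m n : WithTop ℕ∞} (hf : ContDiff ℝ n f) (h : m + 1 ≤ n) :
    ContDiff ℝ m (pd1 f) :=
  (hf.fderiv_right h).clm_apply contDiff_const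

lemma ContDiff.pd2 {f : ℝ × ℝ → ℝ} {m n : WithTop ℕ∞} (hf : ContDiff ℝ n f) (h : m + 1 ≤ n) :
    ContDiff ℝ m (pd2 f) :=
  (hf.fderiv_right h).clm_apply contDiff_const

lemma pd1_pd2_comm {f : ℝ × ℝ → ℝ} (hf : ContDiff ℝ 2 f) : pd1 (pd2 f) = pd2 (pd1 f) := by
  funext q
  have hd : DifferentiableAt ℝ (fderiv ℝ f) q :=
    ((hf.fderiv_right (m := 1) (by norm_num)).differentiable (by norm_num)) q
  have key : ∀ v w : ℝ × ℝ,
      fderiv ℝ (fun p => fderiv ℝ f p v) q w = fderiv ℝ (fderiv ℝ f) q w v := by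
    intro v w
    rw [fderiv_clm_apply hd (differentiableAt_const v)]
    simp
  have hs : IsSymmSndFDerivAt ℝ f q := hf.contDiffAt.isSymmSndFDerivAt (by simp)
  exact (key _ _).trans ((hs.eq _ _).trans (key _ _).symm)

lemma pd1_add {f g : ℝ × ℝ → ℝ} (hf : Differentiable ℝ f) (hg : Differentiable ℝ g) :
    pd1 (fun q => f q + g q) = fun q => pd1 f q + pd1 g q := by
  funext q
  simp [pd1, fderiv_fun_add (hf q) (hg q)]

lemma pd2_add {f g : ℝ × ℝ → ℝ} (hf : Differentiable ℝ f) (hg : Differentiable ℝ g) :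
    pd2 (fun q => f q + g q) = fun q => pd2 f q + pd2 g q := by
  funext q
  simp [pd2, fderiv_fun_add (hf q) (hg q)]

/-- The angular derivative `x₁ ∂₂f − x₂ ∂₁f`. -/
noncomputable def angularDeriv (f : ℝ × ℝ → ℝ) (q : ℝ × ℝ) : ℝ := q.1 * pd2 f q - q.2 * pd1 f q

lemma ContDiff.angularDeriv {f : ℝ × ℝ → ℝ} {m n : WithTop ℕ∞} (hf : ContDiff ℝ n f)
    (h : m + 1 ≤ n) : ContDiff ℝ m (angularDeriv f) :=
  (contDiff_fst.mul (hf.pd2 h)).sub (contDiff_snd.mul (hf.pd1 h))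

lemma fderiv_fst_mul_sub_snd_mul {f g : ℝ × ℝ → ℝ} (hf : Differentiable ℝ f)
    (hg : Differentiable ℝ g) (q v : ℝ × ℝ) :
    fderiv ℝ (fun p : ℝ × ℝ => p.1 * f p - p.2 * g p) q v =
      q.1 * fderiv ℝ f q v - q.2 * fderiv ℝ g q v + (v.1 * f q - v.2 * g q) := by
  have h := ((hasFDerivAt_fst (𝕜 := ℝ) (p := q)).mul (hf q).hasFDerivAt).sub
    ((hasFDerivAt_snd (𝕜 := ℝ) (p := q)).mul (hg q).hasFDerivAt)
  have h' := congrArg (fun L => L v) h.fderiv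
  refine h'.trans ?_
  simp
  ring

lemma pd1_angularDeriv {f : ℝ × ℝ → ℝ} (hf : ContDiff ℝ 2 f) :
    pd1 (angularDeriv f) = fun q => angularDeriv (pd1 f) q + pd2 f q := by
  funext q
  have h1 := (hf.pd1 (m := 1) (by norm_num)).differentiable (by norm_num)
  have h2 := (hf.pd2 (m := 1) (by norm_num)).differentiable (by norm_num)
  have h := fderiv_fst_mul_sub_snd_mul h2 h1 q (1, 0)
  rw [angularDeriv, ← pd1_pd2_comm hf]
  refine h.trans ?_
  simp [pd1]

lemma pd2_angularDeriv {f : ℝ × ℝ → ℝ} (hf : ContDiff ℝ 2 f) :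
    pd2 (angularDeriv f) = fun q => angularDeriv (pd2 f) q + -pd1 f q := by
  funext q
  have h1 := (hf.pd1 (m := 1) (by norm_num)).differentiable (by norm_num)
  have h2 := (hf.pd2 (m := 1) (by norm_num)).differentiable (by norm_num)
  have h := fderiv_fst_mul_sub_snd_mul h2 h1 q (0, 1)
  rw [angularDeriv, pd1_pd2_comm hf]
  refine h.trans ?_
  simp [pd2]

/-- The Laplacian commutes with the angular derivative. -/
lemma lap_angularDeriv {f : ℝ × ℝ → ℝ} (hf : ContDiff ℝ 3 f) (q : ℝ × ℝ) :
    lap (angularDeriv f) q = angularDeriv (lap f) q := by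
  have hf2 : ContDiff ℝ 2 f := hf.of_le (by norm_num)
  have h1 : ContDiff ℝ 2 (pd1 f) := hf.pd1 (by norm_num)
  have h2 : ContDiff ℝ 2 (pd2 f) := hf.pd2 (by norm_num)
  have hd {g : ℝ × ℝ → ℝ} (hg : ContDiff ℝ 1 g) : Differentiable ℝ g :=
    hg.differentiable (by norm_num)
  have hneg : pd2 (fun p => -pd1 f p) q = -pd2 (pd1 f) q := by
    simp [pd2]
  have hlap : lap f = fun p => pd1 (pd1 f) p + pd2 (pd2 f) p := rfl
  have h11 := hd (h1.pd1 (m := 1) (by norm_num))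
  have h22 := hd (h2.pd2 (m := 1) (by norm_num))
  rw [lap, pd1_angularDeriv hf2, pd2_angularDeriv hf2,
    pd1_add (hd (h1.angularDeriv (by norm_num))) (hd (h2.of_le (by norm_num))),
    pd2_add (g := fun p => -pd1 f p) (hd (h2.angularDeriv (by norm_num)))
      (hd (h1.of_le (by norm_num))).neg,
    pd1_angularDeriv h1, pd2_angularDeriv h2]
  simp only [hneg, angularDeriv, hlap, pd1_add h11 h22, pd2_add h11 h22]
  ring

/-- The rotation of `x` by the angle `t` about the origin. -/
noncomputable def rot (x : ℝ × ℝ) (t : ℝ) : ℝ × ℝ :=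
  (x.1 * cos t - x.2 * sin t, x.1 * sin t + x.2 * cos t)

lemma rot_zero (x : ℝ × ℝ) : rot x 0 = x := by simp [rot]

lemma nrm_rot (x : ℝ × ℝ) (t : ℝ) : nrm (rot x t) = nrm x := by
  simp only [nrm, rot]
  congr 1
  linear_combination (x.1 ^ 2 + x.2 ^ 2) * sin_sq_add_cos_sq t

lemma rot_mem_ann {x : ℝ × ℝ} (hx : x ∈ ann) (t : ℝ) : rot x t ∈ ann := by
  simpa only [ann, Set.mem_ofPred_eq, nrm_rot] using hx

lemma exists_rot_eq (x : ℝ × ℝ) : ∃ t, rot (nrm x, 0) t = x := by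
  refine ⟨Complex.arg ⟨x.1, x.2⟩, ?_⟩
  have hn : nrm x = ‖(⟨x.1, x.2⟩ : ℂ)‖ := by
    rw [Complex.norm_def, Complex.normSq_mk, nrm]
    ring_nf
  simp only [rot, hn, zero_mul, sub_zero, add_zero, Complex.norm_mul_cos_arg,
    Complex.norm_mul_sin_arg]

lemma hasDerivAt_comp_rot {f : ℝ × ℝ → ℝ} (hf : Differentiable ℝ f) (x : ℝ × ℝ) (t : ℝ) :
    HasDerivAt (fun s => f (rot x s)) (angularDeriv f (rot x t)) t := by
  have hr : HasDerivAt (rot x) (-(rot x t).2, (rot x t).1) t := by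
    refine HasDerivAt.prodMk ?_ ?_
    · refine (((hasDerivAt_cos t).const_mul x.1).sub
        ((hasDerivAt_sin t).const_mul x.2)).congr_deriv ?_
      simp only [rot]; ring
    · refine (((hasDerivAt_sin t).const_mul x.1).add
        ((hasDerivAt_cos t).const_mul x.2)).congr_deriv ?_
      simp only [rot]; ring
  refine ((hf (rot x t)).hasFDerivAt.comp_hasDerivAt t hr).congr_deriv ?_
  have hv : (-(rot x t).2, (rot x t).1) =
      (-(rot x t).2) • ((1, 0) : ℝ × ℝ) + (rot x t).1 • ((0, 1) : ℝ × ℝ) := by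
    simp
  rw [hv, map_add, map_smul, map_smul]
  simp only [angularDeriv, pd1, pd2, smul_eq_mul]
  ring

/-- Rigidity in the annulus from triviality of the kernel of the linearized
operator: if `Δψ = F(ψ)` in the annulus with `ψ` constant on each boundary
circle and the only `C²` solution of `Δu = F'(ψ)u` vanishing on both boundary
circles is `u ≡ 0`, then `ψ` is radial. -/
theorem rigidity_trivial_kernel_annulus
    (F : ℝ → ℝ) (hF : ContDiff ℝ 1 F)
    (ψ : ℝ × ℝ → ℝ) (hψ : ContDiff ℝ 3 ψ)
    (heq : ∀ x ∈ ann, lap ψ x = F (ψ x))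
    (c₀ c₁ : ℝ)
    (hbc₀ : ∀ x : ℝ × ℝ, nrm x = 1 → ψ x = c₀)
    (hbc₁ : ∀ x : ℝ × ℝ, nrm x = 2 → ψ x = c₁)
    (hker : ∀ u : ℝ × ℝ → ℝ, ContDiff ℝ 2 u →
      (∀ x : ℝ × ℝ, nrm x = 1 ∨ nrm x = 2 → u x = 0) →
      (∀ x ∈ ann, lap u x = deriv F (ψ x) * u x) →
      ∀ x ∈ ann, u x = 0) :
    (∀ x ∈ ann, x.1 * pd2 ψ x - x.2 * pd1 ψ x = 0) ∧
      ∃ Ψ : ℝ → ℝ, ∀ x ∈ ann, ψ x = Ψ (nrm x) := by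
  have hψd : Differentiable ℝ ψ := hψ.differentiable (by norm_num)
  have hlapd : Differentiable ℝ (lap ψ) :=
    (((hψ.pd1 (m := 2) (by norm_num)).pd1 (m := 1) (by norm_num)).add
      ((hψ.pd2 (m := 2) (by norm_num)).pd2 (m := 1) (by norm_num))).differentiable (by norm_num)
  have hbdry : ∀ r c : ℝ, (∀ x : ℝ × ℝ, nrm x = r → ψ x = c) →
      ∀ x : ℝ × ℝ, nrm x = r → angularDeriv ψ x = 0 := by
    intro r c h x hx
    have h1 := hasDerivAt_comp_rot hψd x 0
    have h2 : (fun s => ψ (rot x s)) = fun _ => c :=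
      funext fun s => h _ ((nrm_rot x s).trans hx)
    rw [h2, rot_zero] at h1
    exact h1.unique (hasDerivAt_const 0 c)
  have hu : ∀ x ∈ ann, angularDeriv ψ x = 0 := by
    refine hker _ (hψ.angularDeriv (by norm_num)) ?_ ?_
    · rintro x (hx | hx)
      · exact hbdry 1 c₀ hbc₀ x hx
      · exact hbdry 2 c₁ hbc₁ x hx
    · intro x hx
      rw [lap_angularDeriv hψ]
      have h1 := hasDerivAt_comp_rot hlapd x 0
      have h2 : (fun s => lap ψ (rot x s)) = fun s => F (ψ (rot x s)) :=
        funext fun s => heq _ (rot_mem_ann hx s)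
      have h3 := ((hF.differentiable (by norm_num)) (ψ (rot x 0))).hasDerivAt.comp 0
        (hasDerivAt_comp_rot hψd x 0)
      rw [h2] at h1
      simpa only [rot_zero] using h1.unique h3
  refine ⟨hu, fun r => ψ (r, 0), fun x hx => ?_⟩
  obtain ⟨t, ht⟩ := exists_rot_eq x
  have hmem : ((nrm x, 0) : ℝ × ℝ) ∈ ann := by
    have := nrm_rot (nrm x, 0) t
    rw [ht] at this
    simpa only [ann, Set.mem_ofPred_eq, ← this] using hx
  have hconst := is_const_of_deriv_eq_zero
    (fun s => (hasDerivAt_comp_rot hψd (nrm x, 0) s).differentiableAt)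
    (fun s => (hasDerivAt_comp_rot hψd (nrm x, 0) s).deriv.trans (hu _ (rot_mem_ann hmem s))) t 0
  simpa only [ht, rot_zero] using hconst
end

section
/- Let Ω = 𝕋 × [0,1] be the periodic channel and let v₀ ∈ C²([0,1]) satisfy v₀(y₂) ≠ 0 for all y₂ ∈ [0,1]. Then for every u ∈ C²(Ω) (2π-periodic in y₁) that vanishes on the boundary lines {y₂ = 0} and {y₂ = 1}, the following identity holds: ∫_Ω u(y) ( Δu(y) − (v₀''(y₂)/v₀(y₂)) u(y) ) dy₁ dy₂ = − ∫_Ω v₀(y₂)² |∇( u(y) / v₀(y₂) )|² dy₁ dy₂. -/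
open Real MeasureTheory

/-- One period of the periodic channel `𝕋 × [0,1]`. -/
noncomputable def chanPer : Set (ℝ × ℝ) := Set.Icc (0 : ℝ) (2 * π) ×ˢ Set.Icc (0 : ℝ) 1

theorem ContDiff.fderiv_apply_const {f : ℝ × ℝ → ℝ} (hf : ContDiff ℝ 2 f) (e : ℝ × ℝ) :
    ContDiff ℝ 1 (fun q => fderiv ℝ f q e) :=
  (hf.fderiv_right (m := 1) (by norm_num)).clm_apply contDiff_const

theorem HasDerivAt.hasFDerivAt_comp_snd {w : ℝ → ℝ} {w' : ℝ} {q : ℝ × ℝ}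
    (h : HasDerivAt w w' q.2) :
    HasFDerivAt (fun x : ℝ × ℝ => w x.2) (w' • ContinuousLinearMap.snd ℝ ℝ ℝ) q :=
  h.comp_hasFDerivAt q hasFDerivAt_snd

/-- The weighted gradient of `u / v` in terms of the logarithmic derivative of `v`. -/
theorem sq_mul_grad_div_sq {v : ℝ → ℝ} (hv : ContDiff ℝ 2 v) {u : ℝ × ℝ → ℝ}
    (hu : ContDiff ℝ 2 u) {q : ℝ × ℝ} (hq : v q.2 ≠ 0) :
    (v q.2) ^ 2 *
        ((pd1 (fun x => u x / v x.2) q) ^ 2 + (pd2 (fun x => u x / v x.2) q) ^ 2)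
      = pd1 u q ^ 2 + (pd2 u q - u q * (deriv v q.2 / v q.2)) ^ 2 := by
  have hvd : HasDerivAt v (deriv v q.2) q.2 := (hv.differentiable (by norm_num) _).hasDerivAt
  have hud := (hu.differentiable (by norm_num) q).hasFDerivAt
  have h := (hud.mul (hvd.inv hq).hasFDerivAt_comp_snd).fderiv
  have e : (fun x : ℝ × ℝ => u x / v x.2) = u * fun x => v⁻¹ x.2 := by
    ext x; simp [div_eq_mul_inv]
  simp only [pd1, pd2, e, h]
  simp
  field_simp
  ring

theorem setIntegral_divergence_chanPer {f g : ℝ × ℝ → ℝ}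
    {f' g' : ℝ × ℝ → ℝ × ℝ →L[ℝ] ℝ}
    (hf : ∀ q ∈ chanPer, HasFDerivAt f (f' q) q)
    (hg : ∀ q ∈ chanPer, HasFDerivAt g (g' q) q)
    (hint : IntegrableOn (fun q => f' q (1, 0) + g' q (0, 1)) chanPer)
    (hper : ∀ y, f (2 * π, y) = f (0, y))
    (h0 : ∀ x, g (x, 0) = 0) (h1 : ∀ x, g (x, 1) = 0) :
    ∫ q in chanPer, (f' q (1, 0) + g' q (0, 1)) = 0 := by
  have hc : chanPer = Set.Icc ((0 : ℝ), (0 : ℝ)) (2 * π, 1) := by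
    rw [chanPer, Set.Icc_prod_Icc]
  have hi : ∀ q ∈ Set.Ioo (0 : ℝ) (2 * π) ×ˢ Set.Ioo (0 : ℝ) 1 \ ∅, q ∈ chanPer := fun q hq =>
    ⟨Set.Ioo_subset_Icc_self hq.1.1, Set.Ioo_subset_Icc_self hq.1.2⟩
  rw [hc] at hint ⊢
  rw [integral_divergence_prod_Icc_of_hasFDerivAt_off_countable_of_le f g f' g' (0, 0) (2 * π, 1)
    ⟨by positivity, zero_le_one⟩ ∅ Set.countable_empty
    (fun q hq => (hf q (hc ▸ hq)).continuousAt.continuousWithinAt)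
    (fun q hq => (hg q (hc ▸ hq)).continuousAt.continuousWithinAt)
    (fun q hq => hf q (hi q hq)) (fun q hq => hg q (hi q hq)) hint]
  simp [hper, h0, h1]

/-- Quadratic form identity for the linearized operator around a
non-stagnant shear flow `u₀ = (v₀(y₂), 0)`:
`∫ u (Δu − (v₀''/v₀) u) = − ∫ v₀² |∇(u/v₀)|²` for periodic `u` vanishing
on the boundary lines. -/
theorem shear_quadratic_form_identity
    (v : ℝ → ℝ) (hv : ContDiff ℝ 2 v)
    (hvne : ∀ y ∈ Set.Icc (0 : ℝ) 1, v y ≠ 0)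
    (u : ℝ × ℝ → ℝ) (hu : ContDiff ℝ 2 u)
    (huper : ∀ q : ℝ × ℝ, u (q.1 + 2 * π, q.2) = u q)
    (hbc : ∀ q : ℝ × ℝ, (q.2 = 0 ∨ q.2 = 1) → u q = 0) :
    ∫ q in chanPer, u q * (lap u q - (deriv (deriv v) q.2 / v q.2) * u q)
      = - ∫ q in chanPer,
          (v q.2) ^ 2 *
            ((pd1 (fun x => u x / v x.2) q) ^ 2 + (pd2 (fun x => u x / v x.2) q) ^ 2) := by
  have hvd (y : ℝ) : HasDerivAt v (deriv v y) y := (hv.differentiable (by norm_num) y).hasDerivAt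
  have hv1 : ContDiff ℝ 1 (deriv v) := ContDiff.deriv' hv
  have hvdd (y : ℝ) : HasDerivAt (deriv v) (deriv (deriv v) y) y :=
    (hv1.differentiable (by norm_num) y).hasDerivAt
  have hu1 : ContDiff ℝ 1 (pd1 u) := hu.fderiv_apply_const _
  have hu2 : ContDiff ℝ 1 (pd2 u) := hu.fderiv_apply_const _
  have hne : ∀ q ∈ chanPer, v q.2 ≠ 0 := fun q hq => hvne _ hq.2
  have hmeas : MeasurableSet chanPer := measurableSet_Icc.prod measurableSet_Icc
  have hcpt : IsCompact chanPer := isCompact_Icc.prod isCompact_Icc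
  have hcu : Continuous u := hu.continuous
  have hcu1 : Continuous (pd1 u) := hu1.continuous
  have hcu2 : Continuous (pd2 u) := hu2.continuous
  have hcv : Continuous v := hv.continuous
  have hcv1 : Continuous (deriv v) := hv1.continuous
  have hcv2 : Continuous (deriv (deriv v)) := hv1.continuous_deriv le_rfl
  have hclap : Continuous (lap u) :=
    ((hu1.continuous_fderiv (by norm_num)).clm_apply continuous_const).add
      ((hu2.continuous_fderiv (by norm_num)).clm_apply continuous_const)
  have hintL : IntegrableOn
      (fun q => u q * (lap u q - (deriv (deriv v) q.2 / v q.2) * u q)) chanPer :=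
    ContinuousOn.integrableOn_compact hcpt (by fun_prop (disch := assumption))
  have hintR : IntegrableOn
      (fun q => pd1 u q ^ 2 + (pd2 u q - u q * (deriv v q.2 / v q.2)) ^ 2) chanPer :=
    ContinuousOn.integrableOn_compact hcpt (by fun_prop (disch := assumption))
  rw [setIntegral_congr_fun hmeas fun q hq => sq_mul_grad_div_sq hv hu (hne q hq),
    eq_neg_iff_add_eq_zero, ← integral_add hintL hintR]
  have hud (q : ℝ × ℝ) := (hu.differentiable (by norm_num) q).hasFDerivAt
  have hf (q : ℝ × ℝ) := (hud q).mul (hu1.differentiable (by norm_num) q).hasFDerivAt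
  have hg (q : ℝ × ℝ) (hq : q ∈ chanPer) :=
    ((hud q).mul (hu2.differentiable (by norm_num) q).hasFDerivAt).sub
      (((hud q).mul (hud q)).mul ((hvdd q.2).div (hvd q.2) (hne q hq)).hasFDerivAt_comp_snd)
  have hperpd (y : ℝ) : pd1 u (2 * π, y) = pd1 u (0, y) := by
    have h : (fun q => u (q + (2 * π, 0))) = u := by
      ext q
      simpa [Prod.add_def] using huper q
    have := fderiv_comp_add_right (𝕜 := ℝ) (f := u) (x := (0, y)) (2 * π, 0)
    rw [h] at this
    simp [pd1, this]
  have hb0 (x : ℝ) : u (x, 0) = 0 := hbc _ (Or.inl rfl)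
  have hb1 (x : ℝ) : u (x, 1) = 0 := hbc _ (Or.inr rfl)
  have hper (y : ℝ) : u (2 * π, y) = u (0, y) := by simpa using huper (0, y)
  have key := setIntegral_divergence_chanPer (fun q _ => hf q) hg
  refine (setIntegral_congr_fun hmeas fun q hq => ?_).trans (key ?_ ?_ ?_ ?_)
  · have := hne q hq
    simp [lap, pd1, pd2]
    field_simp
    ring
  · refine (hintL.add hintR).congr_fun (fun q hq => ?_) hmeas
    have := hne q hq
    simp [lap, pd1, pd2]
    field_simp
    ring
  · simp [hper, hperpd]
  · simp [hb0]
  · simp [hb1]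
end
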